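/- arXiv:1004.3603 — 2 statements merged into one kernel-verified Lean document; each statement's English description precedes it below -/
import Mathlib

section
/- Let F be an algebraically closed field of characteristic different from 2. Every square matrix M over F is congruent to a block-diagonal direct sum of matrices, each of which is of one of the following three forms: (a) the skew sum [J_m(λ) ╲ I_m] with λ ∈ F and λ ≠ (−1)^{m+1}; (b) Γ_r; (c) J_s(0) with s odd. -/
open Matrix Polynomial

variable {F : Type*} [Field F]

/-- `M ∈ Ξ_n(F)`: every invertible `S` with `SᵀMS = M` has `det S = 1`. -/
def XiMem {n : ℕ} (M : Matrix (Fin n) (Fin n) F) : Prop :=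
  ∀ S : Matrix (Fin n) (Fin n) F, IsUnit S → Sᵀ * M * S = M → S.det = 1

/-- Congruence of square matrices: `SᵀAS = B` for some invertible `S`. -/
def MatCongruent {n : ℕ} (A B : Matrix (Fin n) (Fin n) F) : Prop :=
  ∃ S : Matrix (Fin n) (Fin n) F, IsUnit S ∧ Sᵀ * A * S = B

/-- Similarity of square matrices: `S⁻¹AS = B` for some invertible `S`. -/
def MatSimilar {n : ℕ} (A B : Matrix (Fin n) (Fin n) F) : Prop :=
  ∃ S : Matrix (Fin n) (Fin n) F, IsUnit S ∧ S⁻¹ * A * S = B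

/-- Block-diagonal direct sum `A ⊕ B`. -/
def dSum {a b : ℕ} (A : Matrix (Fin a) (Fin a) F) (B : Matrix (Fin b) (Fin b) F) :
    Matrix (Fin (a + b)) (Fin (a + b)) F :=
  Matrix.reindex finSumFinEquiv finSumFinEquiv (Matrix.fromBlocks A 0 0 B)

/-- Skew sum `[A ╲ B] = [[0, B], [A, 0]]` of two `m × m` matrices. -/
def skewSum {m : ℕ} (A B : Matrix (Fin m) (Fin m) F) :
    Matrix (Fin (m + m)) (Fin (m + m)) F :=
  Matrix.reindex finSumFinEquiv finSumFinEquiv (Matrix.fromBlocks 0 B A 0)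

/-- `A` is a direct summand of `M` for congruence. -/
def CongSummand {n r : ℕ} (M : Matrix (Fin n) (Fin n) F)
    (A : Matrix (Fin r) (Fin r) F) : Prop :=
  ∃ (s : ℕ) (h : r + s = n) (B : Matrix (Fin s) (Fin s) F),
    MatCongruent M (Matrix.reindex (finCongr h) (finCongr h) (dSum A B))

/-- `A` is a direct summand of `M` for similarity. -/
def SimSummand {n r : ℕ} (M : Matrix (Fin n) (Fin n) F)
    (A : Matrix (Fin r) (Fin r) F) : Prop :=
  ∃ (s : ℕ) (h : r + s = n) (B : Matrix (Fin s) (Fin s) F),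
    MatSimilar M (Matrix.reindex (finCongr h) (finCongr h) (dSum A B))

/-- `(A, B)` is a direct summand of the pair `(M, N)` for equivalence:
`(M, N)` is equivalent to `(A, B) ⊕ (C, D)` for some pair `(C, D)`. -/
def PairSummand {n a b : ℕ} (M N : Matrix (Fin n) (Fin n) F)
    (A B : Matrix (Fin a) (Fin b) F) : Prop :=
  ∃ (c d : ℕ) (hc : a + c = n) (hd : b + d = n)
    (C D : Matrix (Fin c) (Fin d) F)
    (R S : Matrix (Fin n) (Fin n) F), IsUnit R ∧ IsUnit S ∧
      R * M * S = Matrix.reindex (finSumFinEquiv.trans (finCongr hc))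
          (finSumFinEquiv.trans (finCongr hd)) (Matrix.fromBlocks A 0 0 C) ∧
      R * N * S = Matrix.reindex (finSumFinEquiv.trans (finCongr hc))
          (finSumFinEquiv.trans (finCongr hd)) (Matrix.fromBlocks B 0 0 D)

/-- The `r × r` Jordan block `J_r(λ)`: `λ` on the diagonal, `1` on the subdiagonal. -/
def jordanBlock (r : ℕ) (lam : F) : Matrix (Fin r) (Fin r) F :=
  Matrix.of fun i j =>
    if (i : ℕ) = (j : ℕ) then lam else if (i : ℕ) = (j : ℕ) + 1 then 1 else 0

/-- The matrix `Γ_r`: with 1-based indices, entry `(i, j)` is `(-1)^(r - i)` if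
`i + j = r + 1` or `i + j = r + 2`, and `0` otherwise. -/
def Gam (r : ℕ) : Matrix (Fin r) (Fin r) F :=
  Matrix.of fun i j =>
    if (i : ℕ) + (j : ℕ) = r - 1 ∨ (i : ℕ) + (j : ℕ) = r then
      (-1 : F) ^ (r - 1 - (i : ℕ)) else 0

/-- Companion matrix of a monic polynomial `x^m + c₁x^(m-1) + ⋯ + c_m`:
`1`'s on the subdiagonal, last column `(-c_m, …, -c₂, -c₁)ᵀ`. -/
def companion (q : Polynomial F) : Matrix (Fin q.natDegree) (Fin q.natDegree) F :=
  Matrix.of fun i j =>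
    if (j : ℕ) = q.natDegree - 1 then -q.coeff (i : ℕ)
    else if (i : ℕ) = (j : ℕ) + 1 then 1 else 0

/-- A Frobenius block: the companion matrix of `p^l` with `p` monic irreducible, `l ≥ 1`. -/
def IsFrobeniusBlock {m : ℕ} (A : Matrix (Fin m) (Fin m) F) : Prop :=
  ∃ (p : Polynomial F) (l : ℕ), p.Monic ∧ Irreducible p ∧ 1 ≤ l ∧
    ∃ h : (p ^ l).natDegree = m,
      A = Matrix.reindex (finCongr h) (finCongr h) (companion (p ^ l))

/-- `Φ` is a cosquare: `Φ = A⁻ᵀA` for some invertible `A`. -/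
def IsCosquare {m : ℕ} (A : Matrix (Fin m) (Fin m) F) : Prop :=
  ∃ Q : Matrix (Fin m) (Fin m) F, IsUnit Q ∧ Q⁻¹ᵀ * Q = A

/-- The `(t-1) × t` matrix `F_t` with `F_t(i, j) = 1` iff `j = i`. -/
def Fmat (t : ℕ) : Matrix (Fin (t - 1)) (Fin t) F :=
  Matrix.of fun i j => if (j : ℕ) = (i : ℕ) then 1 else 0

/-- The `(t-1) × t` matrix `G_t` with `G_t(i, j) = 1` iff `j = i + 1`. -/
def Gmat (t : ℕ) : Matrix (Fin (t - 1)) (Fin t) F :=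
  Matrix.of fun i j => if (j : ℕ) = (i : ℕ) + 1 then 1 else 0

/-- A canonical block for congruence over an algebraically closed field of
characteristic not 2: (a) `[J_m(λ) ╲ I_m]` with `λ ≠ (-1)^(m+1)`; (b) `Γ_r`;
(c) `J_s(0)` with `s` odd. -/
def GoodBlock14 {F : Type*} [Field F] {m : ℕ} (A : Matrix (Fin m) (Fin m) F) : Prop :=
  (∃ (r : ℕ) (h : r + r = m) (lam : F), lam ≠ (-1 : F) ^ (r + 1) ∧
      A = Matrix.reindex (finCongr h) (finCongr h)
            (skewSum (jordanBlock r lam) (1 : Matrix (Fin r) (Fin r) F))) ∨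
  (A = Gam m) ∨
  (Odd m ∧ A = jordanBlock m (0 : F))

/-- A polynomial that splits with nonzero roots divides `p ^ 2 - X` for some `p`. -/
theorem exists_prod_dvd_sq_sub_X [IsAlgClosed F] (h2 : (2 : F) ≠ 0) (s : Multiset F)
    (hs : ∀ a ∈ s, a ≠ 0) :
    ∃ p : F[X], (s.map fun a => X - C a).prod ∣ p ^ 2 - X := by
  induction s using Multiset.induction_on with
  | empty => exact ⟨0, by simp⟩
  | cons a s ih =>
    obtain ⟨p, q, hq⟩ := ih fun b hb => hs b (Multiset.mem_cons_of_mem hb)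
    set g := (s.map fun a => X - C a).prod
    have ha : a ≠ 0 := hs a (Multiset.mem_cons_self a s)
    have hroot : ∃ h : F, q.eval a + 2 * p.eval a * h + g.eval a * h ^ 2 = 0 := by
      have hev : p.eval a ^ 2 - a = g.eval a * q.eval a := by
        simpa using congrArg (Polynomial.eval a) hq
      by_cases hg : g.eval a = 0
      · have hp : p.eval a ≠ 0 := by
          intro hp
          rw [hg, hp] at hev
          exact ha (by linear_combination -hev)
        refine ⟨-q.eval a / (2 * p.eval a), ?_⟩
        rw [hg]
        field_simp
        ring
      · obtain ⟨z, hz⟩ := IsAlgClosed.exists_pow_nat_eq a (n := 2) (by norm_num)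
        refine ⟨(z - p.eval a) / g.eval a, ?_⟩
        field_simp
        linear_combination hz - hev
    obtain ⟨h, hh⟩ := hroot
    have hdvd : X - C a ∣ q + 2 * p * C h + g * C h ^ 2 := by
      rw [Polynomial.dvd_iff_isRoot]
      simpa [Polynomial.IsRoot] using hh
    refine ⟨p + g * C h, ?_⟩
    rw [Multiset.map_cons, Multiset.prod_cons, mul_comm]
    refine (mul_dvd_mul_left g hdvd).trans (dvd_of_eq ?_)
    linear_combination -hq

/-- An invertible matrix has a square root that is a polynomial in it. -/
theorem exists_aeval_sq_eq [IsAlgClosed F] (h2 : (2 : F) ≠ 0) {ι : Type*} [Fintype ι]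
    [DecidableEq ι] {A : Matrix ι ι F} (hA : IsUnit A) : ∃ p : F[X], aeval A p ^ 2 = A := by
  have hroots : ∀ a ∈ A.charpoly.roots, a ≠ 0 := by
    rintro a ha rfl
    have h0 := Polynomial.isRoot_of_mem_roots ha
    rw [Polynomial.IsRoot, ← Polynomial.coeff_zero_eq_eval_zero] at h0
    refine ((Matrix.isUnit_iff_isUnit_det A).1 hA).ne_zero ?_
    rw [Matrix.det_eq_sign_charpoly_coeff, h0, mul_zero]
  obtain ⟨p, hp⟩ := exists_prod_dvd_sq_sub_X h2 _ hroots
  rw [← (IsAlgClosed.splits A.charpoly).eq_prod_roots_of_monic A.charpoly_monic] at hp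
  obtain ⟨q, hq⟩ := hp
  refine ⟨p, ?_⟩
  have h := congrArg (aeval A) hq
  simpa [Matrix.aeval_self_charpoly, sub_eq_zero] using h

/-- Invertible matrices with the same cosquare are congruent. -/
theorem exists_congr_of_cosquare_eq [IsAlgClosed F] (h2 : (2 : F) ≠ 0) {ι : Type*} [Fintype ι]
    [DecidableEq ι] {G M : Matrix ι ι F} (hG : IsUnit G) (hM : IsUnit M)
    (h : Mᵀ = M * G⁻¹ * Gᵀ) : ∃ P : Matrix ι ι F, IsUnit P ∧ Pᵀ * G * P = M := by
  have hGd : IsUnit G.det := (Matrix.isUnit_iff_isUnit_det G).1 hG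
  have hGA : G * (G⁻¹ * M) = M := Matrix.mul_nonsing_inv_cancel_left G M hGd
  have hA : IsUnit (G⁻¹ * M) := (Matrix.isUnit_nonsing_inv_iff.2 hG).mul hM
  set A := G⁻¹ * M with hAdef
  have hAG : Aᵀ * G = G * A := by
    rw [hGA, hAdef, Matrix.transpose_mul, Matrix.transpose_nonsing_inv, h]
    rw [Matrix.mul_nonsing_inv_cancel_right _ _ (by rwa [Matrix.det_transpose])]
    exact Matrix.nonsing_inv_mul_cancel_right G M hGd
  clear_value A
  obtain ⟨p, hp⟩ := exists_aeval_sq_eq h2 hA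
  have key : ∀ q : F[X], (aeval A q)ᵀ * G = G * aeval A q := by
    intro q
    induction q using Polynomial.induction_on with
    | C a => simp [Algebra.algebraMap_eq_smul_one]
    | add q r hq hr => simp [add_mul, mul_add, hq, hr]
    | monomial n a ih =>
      rw [pow_succ, ← mul_assoc, map_mul, aeval_X, Matrix.transpose_mul, Matrix.mul_assoc, ih,
        ← Matrix.mul_assoc, hAG, Matrix.mul_assoc]
      congr 1
      have hX := ((Commute.all (X : F[X]) (C a * X ^ n)).map (aeval A)).eq
      rwa [aeval_X] at hX
  refine ⟨aeval A p, ?_, ?_⟩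
  · rw [← isUnit_pow_iff two_ne_zero, hp]
    exact hA
  · rw [key, Matrix.mul_assoc, ← pow_two, hp, hGA]

section BilinearForm

variable {V : Type*} [AddCommGroup V] [Module F V]

/-- The span of `e` is a free summand of `V` with basis `e`, and it has a complement that is
orthogonal to it on both sides. -/
def IsOrthogonalSummand (B : V →ₗ[F] V →ₗ[F] F) {ι : Type*} [DecidableEq ι] (e : ι → V) : Prop :=
  ∃ φ : ι → Module.Dual F V, (∀ i j, φ i (e j) = if i = j then 1 else 0) ∧
    ∀ w, (∀ i, φ i w = 0) → ∀ i, B (e i) w = 0 ∧ B w (e i) = 0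

/-- The form `B` has an orthogonal summand whose Gram matrix is a canonical block. -/
def HasCanonicalSummand (B : V →ₗ[F] V →ₗ[F] F) : Prop :=
  ∃ (m : ℕ) (A : Matrix (Fin m) (Fin m) F) (e : Fin m → V),
    0 < m ∧ GoodBlock14 A ∧ (∀ i j, B (e i) (e j) = A i j) ∧ IsOrthogonalSummand B e

/-- The form `B` has a block-diagonal Gram matrix with canonical blocks in some basis. -/
def HasCanonicalBasis (B : V →ₗ[F] V →ₗ[F] F) : Prop :=
  ∃ (ι : Type) (_ : Fintype ι) (d : ι → ℕ)
    (blocks : ∀ i : ι, Matrix (Fin (d i)) (Fin (d i)) F) (b : Module.Basis (Σ i, Fin (d i)) F V),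
    (∀ i, GoodBlock14 (blocks i)) ∧ (∀ i x y, B (b ⟨i, x⟩) (b ⟨i, y⟩) = blocks i x y) ∧
      ∀ i j x y, i ≠ j → B (b ⟨i, x⟩) (b ⟨j, y⟩) = 0

/-- Vectors dual to functionals, followed by a basis of the common kernel, form a basis. -/
theorem exists_basis_of_dual {ι κ : Type*} [Fintype ι] [DecidableEq ι] [Fintype κ]
    {e : ι → V} {φ : ι → Module.Dual F V} (hφ : ∀ i j, φ i (e j) = if i = j then 1 else 0)
    (c : Module.Basis κ F (LinearMap.ker (LinearMap.pi φ))) :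
    ∃ b : Module.Basis (ι ⊕ κ) F V, ∀ x, b x = Sum.elim e (fun k => (c k : V)) x := by
  have hker : ∀ w : LinearMap.ker (LinearMap.pi φ), ∀ i, φ i w = 0 := fun w i =>
    congrFun (LinearMap.mem_ker.1 w.2) i
  have hli : LinearIndependent F (Sum.elim e fun k => (c k : V)) := by
    rw [Fintype.linearIndependent_iff]
    intro g hg
    rw [Fintype.sum_sum_type] at hg
    simp only [Sum.elim_inl, Sum.elim_inr] at hg
    have h1 : ∀ i, g (Sum.inl i) = 0 := by
      intro i
      simpa [hφ, hker] using congrArg (φ i) hg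
    have h2 : ∑ k, g (Sum.inr k) • c k = 0 := by
      apply Subtype.ext
      simpa [h1] using hg
    rintro (i | k)
    · exact h1 i
    · exact Fintype.linearIndependent_iff.1 c.linearIndependent _ h2 k
  have hsp : ⊤ ≤ Submodule.span F (Set.range (Sum.elim e fun k => (c k : V))) := by
    intro v _
    have hw : v - ∑ i, φ i v • e i ∈ LinearMap.ker (LinearMap.pi φ) := by
      rw [LinearMap.mem_ker]
      ext i
      simp [hφ]
    have h1 : v = ∑ i, φ i v • e i + ∑ k, c.repr ⟨_, hw⟩ k • (c k : V) := by
      have := congrArg Subtype.val (c.sum_repr ⟨_, hw⟩)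
      simp only [Submodule.coe_sum, Submodule.coe_smul] at this
      rw [this]
      abel
    rw [h1]
    refine Submodule.add_mem _ (Submodule.sum_mem _ fun i _ => Submodule.smul_mem _ _ ?_)
      (Submodule.sum_mem _ fun k _ => Submodule.smul_mem _ _ ?_)
    · exact Submodule.subset_span ⟨Sum.inl i, rfl⟩
    · exact Submodule.subset_span ⟨Sum.inr k, rfl⟩
  exact ⟨Module.Basis.mk hli hsp, fun x => by rw [Module.Basis.mk_apply]⟩

/-- If every nonzero space has a canonical orthogonal summand, every form has a canonical basis. -/
theorem hasCanonicalBasis_of_forall_exists_summand.{u, v} {F : Type u} [Field F]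
    (H : ∀ (V : Type v) [AddCommGroup V] [Module F V] [FiniteDimensional F V] [Nontrivial V]
      (B : V →ₗ[F] V →ₗ[F] F), HasCanonicalSummand B)
    (V : Type v) [AddCommGroup V] [Module F V] [FiniteDimensional F V]
    (B : V →ₗ[F] V →ₗ[F] F) : HasCanonicalBasis B := by
  induction hn : Module.finrank F V using Nat.strong_induction_on generalizing V with
  | _ n ih =>
  rcases subsingleton_or_nontrivial V with hV | hV
  · exact ⟨Empty, inferInstance, Empty.elim, fun i => i.elim, Module.Basis.empty V,
      fun i => i.elim, fun i => i.elim, fun i => i.elim⟩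
  obtain ⟨m, A, e, hm, hA, hBe, φ, hφ, hort⟩ := H V B
  set W := LinearMap.ker (LinearMap.pi φ) with hWdef
  have hker : ∀ w : W, ∀ i, φ i w = 0 := fun w i => congrFun (LinearMap.mem_ker.1 w.2) i
  have hlt : Module.finrank F W < n := by
    rw [← hn]
    apply Submodule.finrank_lt
    intro htop
    have : e ⟨0, hm⟩ ∈ W := htop ▸ Submodule.mem_top
    have := hker ⟨_, this⟩ ⟨0, hm⟩
    simp [hφ] at this
  obtain ⟨ι, _, d, blocks, c, hgood, hin, hout⟩ :=
    ih _ hlt W (B.compl₁₂ W.subtype W.subtype) rfl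
  obtain ⟨b, hb⟩ := exists_basis_of_dual hφ c
  let d' : Unit ⊕ ι → ℕ := Sum.elim (fun _ => m) d
  let E : (Σ i : Unit ⊕ ι, Fin (d' i)) ≃ Fin m ⊕ Σ i, Fin (d i) :=
    (Equiv.sumSigmaDistrib fun i => Fin (d' i)).trans
      (Equiv.sumCongr (Equiv.uniqueSigma fun _ : Unit => Fin m) (Equiv.refl _))
  have hl : ∀ x : Fin m, (b.reindex E.symm) ⟨Sum.inl (), x⟩ = e x := by
    intro x
    rw [Module.Basis.reindex_apply, Equiv.symm_symm]
    exact hb _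
  have hr : ∀ (i : ι) (x : Fin (d i)), (b.reindex E.symm) ⟨Sum.inr i, x⟩ = c ⟨i, x⟩ := by
    intro i x
    rw [Module.Basis.reindex_apply, Equiv.symm_symm]
    exact hb _
  refine ⟨Unit ⊕ ι, inferInstance, d', Sum.rec (fun _ => A) blocks, b.reindex E.symm, ?_, ?_, ?_⟩
  · rintro (i | i)
    exacts [hA, hgood i]
  · rintro (⟨⟩ | i) x y
    · exact (congrArg₂ (fun u v => B u v) (hl x) (hl y)).trans (hBe x y)
    · exact (congrArg₂ (fun u v => B u v) (hr i x) (hr i y)).trans (hin i x y)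
  · rintro (⟨⟩ | i) (⟨⟩ | j) x y hij
    · exact absurd rfl hij
    · exact (congrArg₂ (fun u v => B u v) (hl x) (hr j y)).trans (hort _ (hker _) x).1
    · exact (congrArg₂ (fun u v => B u v) (hr i x) (hl y)).trans (hort _ (hker _) y).2
    · exact (congrArg₂ (fun u v => B u v) (hr i x) (hr j y)).trans
        (hout i j x y (by simpa using hij))

theorem exists_matCongruent_of_hasCanonicalBasis {n : ℕ} (M : Matrix (Fin n) (Fin n) F)
    (h : HasCanonicalBasis (Matrix.toLinearMap₂' F M)) :
    ∃ (k : ℕ) (d : Fin k → ℕ) (blocks : ∀ i : Fin k, Matrix (Fin (d i)) (Fin (d i)) F),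
      (∀ i : Fin k, GoodBlock14 (blocks i)) ∧
      ∃ e : Fin n ≃ (Σ i : Fin k, Fin (d i)),
        MatCongruent M (Matrix.reindex e.symm e.symm (Matrix.blockDiagonal' blocks)) := by
  obtain ⟨ι, _, d, blocks, b, hgood, hin, hout⟩ := h
  let ε := (Fintype.equivFin ι).symm
  let E : (Σ i, Fin (d (ε i))) ≃ Σ i, Fin (d i) :=
    Equiv.sigmaCongrLeft (β := fun i => Fin (d i)) ε
  let b' := b.reindex E.symm
  let e : Fin n ≃ Σ i, Fin (d (ε i)) := (Pi.basisFun F (Fin n)).indexEquiv b'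
  let b'' := b'.reindex e.symm
  refine ⟨_, fun i => d (ε i), fun i => blocks (ε i), fun i => hgood _, e,
    (Pi.basisFun F (Fin n)).toMatrix b'', ?_, ?_⟩
  · have := (Pi.basisFun F (Fin n)).invertibleToMatrix b''
    exact isUnit_of_invertible _
  · have hB : ∀ x y, (((Pi.basisFun F (Fin n)).toMatrix b'')ᵀ * M *
        (Pi.basisFun F (Fin n)).toMatrix b'') x y =
        Matrix.toLinearMap₂' F M (b'' x) (b'' y) := by
      intro x y
      rw [Matrix.toLinearMap₂'_apply']
      simp only [Matrix.mul_apply, dotProduct, Matrix.mulVec, Matrix.transpose_apply,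
        Module.Basis.toMatrix_apply, Pi.basisFun_repr, Finset.sum_mul, Finset.mul_sum]
      rw [Finset.sum_comm]
      simp [mul_assoc]
    have hb : ∀ x, b'' x = b ⟨ε (e x).1, (e x).2⟩ := by
      intro x
      simp only [b'', b', Module.Basis.reindex_apply, Equiv.symm_symm]
      rfl
    ext x y
    rw [hB, hb, hb, Matrix.reindex_apply, Matrix.submatrix_apply, Equiv.symm_symm]
    generalize e x = p
    generalize e y = q
    obtain ⟨i, p⟩ := p
    obtain ⟨j, q⟩ := q
    by_cases hij : i = j
    · subst hij
      rw [Matrix.blockDiagonal'_apply_eq]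
      exact hin _ _ _
    · rw [Matrix.blockDiagonal'_apply_ne _ _ _ hij]
      exact hout _ _ _ _ (by simpa using hij)

theorem IsOrthogonalSummand.comp_equiv {B : V →ₗ[F] V →ₗ[F] F} {ι κ : Type*} [DecidableEq ι]
    [DecidableEq κ] {e : ι → V} (h : IsOrthogonalSummand B e) (σ : κ ≃ ι) :
    IsOrthogonalSummand B (e ∘ σ) := by
  obtain ⟨φ, hφ, hort⟩ := h
  refine ⟨φ ∘ σ, fun i j => by simp [hφ], fun w hw i => hort w (fun k => ?_) (σ i)⟩
  simpa using hw (σ.symm k)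

theorem hasCanonicalSummand_of_skewSum {B : V →ₗ[F] V →ₗ[F] F} {m : ℕ} (hm : 0 < m) {lam : F}
    (hlam : lam ≠ (-1) ^ (m + 1)) {e : Fin m ⊕ Fin m → V}
    (hB : ∀ i j, B (e i) (e j) = fromBlocks 0 1 (jordanBlock m lam) 0 i j)
    (he : IsOrthogonalSummand B e) : HasCanonicalSummand B := by
  refine ⟨m + m, skewSum (jordanBlock m lam) 1, e ∘ finSumFinEquiv.symm, by omega,
    Or.inl ⟨m, rfl, lam, hlam, rfl⟩, fun i j => hB _ _, he.comp_equiv _⟩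

section Degenerate

/-- If `f` vanishes wherever all `C u` do, then `f` is some `C u`. -/
theorem exists_forall_eq_of_forall_eq_zero {U : Type*} [AddCommGroup U] [Module F U]
    [FiniteDimensional F U] (C : U →ₗ[F] V →ₗ[F] F) (f : V →ₗ[F] F)
    (hf : ∀ v, (∀ u, C u v = 0) → f v = 0) : ∃ u, ∀ v, C u v = f v := by
  have h : f ∈ LinearMap.range C.flip.dualMap := by
    rw [LinearMap.range_dualMap_eq_dualAnnihilator_ker, Submodule.mem_dualAnnihilator]
    intro v hv
    exact hf v fun u => LinearMap.congr_fun (LinearMap.mem_ker.1 hv) u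
  obtain ⟨ξ, rfl⟩ := h
  obtain ⟨u, rfl⟩ := (Module.evalEquiv F U).surjective ξ
  exact ⟨u, fun v => by simp⟩

/-- Vectors `e 0, …, e n` whose Gram matrix is `J_{n+1}(0)` and which can be split off from
the space: both one-sided products with each of them are determined by the chain. -/
structure IsNilpotentChain (B : V →ₗ[F] V →ₗ[F] F) (n : ℕ) (e : ℕ → V) : Prop where
  left : ∀ y, B (e 0) y = 0
  right : ∀ y, B y (e n) = 0
  shift : ∀ i, i + 1 < n → ∀ y, B (e (i + 2)) y = B y (e i)
  gram : ∀ i j, i ≤ n → j ≤ n → B (e i) (e j) = if i = j + 1 then 1 else 0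
  ne_zero : e 0 ≠ 0

theorem IsNilpotentChain.isOrthogonalSummand {B : V →ₗ[F] V →ₗ[F] F} {n : ℕ} {e : ℕ → V}
    (h : IsNilpotentChain B n e) : IsOrthogonalSummand B fun i : Fin (n + 1) => e i := by
  rcases n with - | n
  · obtain ⟨f, hf⟩ := Module.Projective.exists_dual_ne_zero F h.ne_zero
    refine ⟨fun _ => (f (e 0))⁻¹ • f, fun i j => ?_, fun w _ i => ?_⟩
    · have hi : i = 0 := Fin.ext (by omega)
      have hj : j = 0 := Fin.ext (by omega)
      subst hi hj
      simp [hf]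
    · have hi : i = 0 := Fin.ext (by omega)
      subst hi
      exact ⟨h.left w, h.right w⟩
  · refine ⟨fun i => if (i : ℕ) < n + 1 then B (e (i + 1)) else B.flip (e n), fun i j => ?_,
      fun w hw i => ?_⟩
    · have hi := i.2
      have hj := j.2
      dsimp only
      simp only [Fin.ext_iff]
      by_cases h1 : (i : ℕ) < n + 1
      · rw [if_pos h1, h.gram _ _ (by omega) (by omega)]
        exact if_congr (by omega) rfl rfl
      · rw [if_neg h1, LinearMap.flip_apply, h.gram _ _ (by omega) (by omega)]
        exact if_congr (by omega) rfl rfl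
    · obtain ⟨i, hi⟩ := i
      have hlt : ∀ j, j < n + 1 → B (e (j + 1)) w = 0 := fun j hj => by
        simpa [hj] using hw ⟨j, by omega⟩
      have hlast : B w (e n) = 0 := by simpa using hw ⟨n + 1, by omega⟩
      constructor
      · rcases i with - | i
        · exact h.left w
        · exact hlt i (by omega)
      · rcases lt_trichotomy i n with hin | rfl | hin
        · rw [← h.shift i (by omega)]
          exact hlt (i + 1) (by omega)
        · exact hlast
        · obtain rfl : i = n + 1 := by omega
          exact h.right w

theorem IsNilpotentChain.hasCanonicalSummand {B : V →ₗ[F] V →ₗ[F] F} {n : ℕ} {e : ℕ → V}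
    (h : IsNilpotentChain B n e) : HasCanonicalSummand B := by
  rcases Nat.even_or_odd (n + 1) with ⟨r, hr⟩ | hodd
  · let g : Fin r ⊕ Fin r → Fin (n + 1) :=
      Sum.elim (fun i => ⟨2 * i + 1, by omega⟩) (fun i => ⟨2 * i, by omega⟩)
    have hg : Function.Bijective g := by
      rw [Fintype.bijective_iff_injective_and_card]
      constructor
      · rintro (i | i) (j | j) hij <;> simp [g, Fin.ext_iff] at hij ⊢ <;> omega
      · simp [hr]
    refine hasCanonicalSummand_of_skewSum (m := r) (by omega) (lam := 0) ?_ ?_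
      (h.isOrthogonalSummand.comp_equiv (Equiv.ofBijective g hg))
    · exact (pow_ne_zero _ (neg_ne_zero.2 one_ne_zero)).symm
    · rintro (i | i) (j | j) <;>
        simp only [Function.comp_apply, Equiv.ofBijective_apply, g, Sum.elim_inl, Sum.elim_inr]
      · rw [h.gram _ _ (by omega) (by omega), if_neg (by omega)]
        rfl
      · rw [h.gram _ _ (by omega) (by omega), fromBlocks_apply₁₂, Matrix.one_apply]
        exact if_congr (by rw [Fin.ext_iff]; omega) rfl rfl
      · rw [h.gram _ _ (by omega) (by omega), fromBlocks_apply₂₁, jordanBlock, Matrix.of_apply]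
        split_ifs <;> first | rfl | omega
      · rw [h.gram _ _ (by omega) (by omega), if_neg (by omega)]
        rfl
  · refine ⟨n + 1, jordanBlock (n + 1) 0, fun i => e i, by omega, Or.inr (Or.inr ⟨hodd, rfl⟩),
      fun i j => ?_, h.isOrthogonalSummand⟩
    rw [h.gram _ _ (by omega) (by omega), jordanBlock, Matrix.of_apply]
    split_ifs <;> first | rfl | omega

/-- A sequence satisfying the conditions of a chain up to one Gram entry can be corrected. -/
theorem exists_isNilpotentChain_of_gram_except {B : V →ₗ[F] V →ₗ[F] F} {n : ℕ} {f : ℕ → V}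
    (left : ∀ y, B (f 0) y = 0) (right : ∀ y, B y (f (n + 2)) = 0)
    (shift : ∀ i, i + 1 < n + 2 → ∀ y, B (f (i + 2)) y = B y (f i))
    (gram : ∀ i j, i ≤ n + 2 → j ≤ n + 2 → (i = 1 → j ≠ n + 1) →
      B (f i) (f j) = if i = j + 1 then 1 else 0)
    (ne_zero : f 0 ≠ 0) : ∃ e, IsNilpotentChain B (n + 2) e := by
  refine ⟨fun i => if i = 1 then f 1 - B (f 1) (f (n + 1)) • f (n + 2) else f i, ?_, ?_, ?_, ?_, ?_⟩
  · simpa using left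
  · simpa using right
  · intro i hi y
    rw [if_neg (by omega)]
    by_cases h1 : i = 1
    · subst h1
      simp [right, shift 1 hi y]
    · rw [if_neg h1]
      exact shift i hi y
  · intro i j hi hj
    have hy : ∀ y, B y (if j = 1 then f 1 - B (f 1) (f (n + 1)) • f (n + 2) else f j) =
        B y (f j) := by
      intro y
      split_ifs with h
      · simp [right, h]
      · rfl
    rw [hy]
    by_cases h1 : i = 1
    · subst h1
      have h2 := gram (n + 2) j le_rfl hj (by omega)
      simp only [if_true, map_sub, map_smul, LinearMap.sub_apply, LinearMap.smul_apply, smul_eq_mul,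
        h2]
      by_cases h3 : j = n + 1
      · subst h3
        simp
      · rw [gram 1 j hi hj (by omega), if_neg (show n + 2 ≠ j + 1 by omega)]
        simp
    · rw [if_neg h1]
      exact gram i j hi hj (by omega)
  · simpa using ne_zero

/-- A chain relative to the left orthogonal of the right radical extends by two vectors. -/
theorem exists_isNilpotentChain_of_chain_on_orthogonal [FiniteDimensional F V]
    {B : V →ₗ[F] V →ₗ[F] F} {n : ℕ} {e : ℕ → V} (V₁ : Submodule F V)
    (hV₁ : ∀ y, y ∈ V₁ ↔ ∀ r ∈ LinearMap.ker B.flip, B r y = 0) (mem : ∀ i, e i ∈ V₁)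
    (left : ∀ y ∈ V₁, B (e 0) y = 0) (right : ∀ y ∈ V₁, B y (e n) = 0)
    (shift : ∀ i, i + 1 < n → ∀ y ∈ V₁, B (e (i + 2)) y = B y (e i))
    (gram : ∀ i j, i ≤ n → j ≤ n → B (e i) (e j) = if i = j + 1 then 1 else 0)
    (notMem : e 0 ∉ LinearMap.ker B.flip) : ∃ e', IsNilpotentChain B (n + 2) e' := by
  set R := LinearMap.ker B.flip with hR
  have hRr : ∀ r ∈ R, ∀ y, B y r = 0 := fun r hr y =>
    LinearMap.congr_fun (LinearMap.mem_ker.1 hr) y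
  have hRe : ∀ r ∈ R, ∀ i, B r (e i) = 0 := fun r hr i => (hV₁ _).1 (mem i) r hr
  have lift_R : ∀ f : V →ₗ[F] F, (∀ y ∈ V₁, f y = 0) → ∃ r ∈ R, ∀ y, B r y = f y := by
    intro f hf
    obtain ⟨r, hr⟩ := exists_forall_eq_of_forall_eq_zero (B.domRestrict R) f fun v hv =>
      hf v ((hV₁ v).2 fun r hr => hv ⟨r, hr⟩)
    exact ⟨r, r.2, hr⟩
  have lift_V : ∀ f : V →ₗ[F] F, (∀ r ∈ R, f r = 0) → ∃ c, ∀ y, B c y = f y := fun f hf =>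
    exists_forall_eq_of_forall_eq_zero B f fun v hv => hf v (LinearMap.mem_ker.2 (by ext; exact hv _))
  obtain ⟨r, hr, hrB⟩ := lift_R (B.flip (e n)) right
  simp only [LinearMap.flip_apply] at hrB
  have hρ : ∀ i, ∃ ρ ∈ R, (i = 0 → ∀ y, B (e i - ρ) y = 0) ∧
      ∀ j, i = j + 2 → i ≤ n → ∀ y, B (e i - ρ) y = B y (e j) := by
    intro i
    rcases i with - | - | i
    · obtain ⟨ρ, h1, h2⟩ := lift_R (B (e 0)) left
      exact ⟨ρ, h1, fun _ y => by simp [h2], by omega⟩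
    · exact ⟨0, zero_mem _, by omega, by omega⟩
    · by_cases hi : i + 1 < n
      · obtain ⟨ρ, h1, h2⟩ := lift_R (B (e (i + 2)) - B.flip (e i)) fun y hy => by
          simp [shift i hi y hy]
        refine ⟨ρ, h1, by omega, fun j hj _ y => ?_⟩
        obtain rfl : i = j := by omega
        simp [h2]
      · exact ⟨0, zero_mem _, by omega, by omega⟩
  choose ρ hρR hρ0 hρs using hρ
  obtain ⟨c, hc, hcs⟩ : ∃ c, (∀ j ≤ n, B c (e j) = if j = n then 1 else 0) ∧
      ∀ j, n = j + 1 → ∀ y, B c y = B y (e j) := by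
    rcases n with - | n
    · obtain ⟨f, hf, hfR⟩ := Submodule.exists_le_ker_of_notMem notMem
      obtain ⟨c, hc⟩ := lift_V ((f (e 0))⁻¹ • f) fun r hr => by
        simp [LinearMap.mem_ker.1 (hfR hr)]
      refine ⟨c, fun j hj => ?_, by omega⟩
      obtain rfl : j = 0 := by omega
      simp [hc, hf]
    · obtain ⟨c, hc⟩ := lift_V (B.flip (e n)) fun r hr => hRe r hr n
      refine ⟨c, fun j hj => ?_, fun j hj y => ?_⟩
      · rw [hc, LinearMap.flip_apply, gram j n hj (by omega)]
      · obtain rfl : n = j := by omega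
        exact hc y
  refine exists_isNilpotentChain_of_gram_except
    (f := fun i => if i ≤ n then e i - ρ i else if i = n + 1 then c else r) ?_ ?_ ?_ ?_ ?_
  · simpa using hρ0 0 rfl
  · simpa using hRr r hr
  · intro i hi y
    have hy : i ≤ n → B y (e i - ρ i) = B y (e i) := fun _ => by simp [hRr _ (hρR i)]
    simp only [if_pos (show i ≤ n by omega), hy (by omega)]
    split_ifs with h1 h2
    · exact hρs (i + 2) i rfl h1 y
    · exact hcs i (by omega) y
    · obtain rfl : i = n := by omega
      exact hrB y
  · intro i j hi hj hij
    have hj' : ∀ y, B y (if j ≤ n then e j - ρ j else if j = n + 1 then c else r) =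
        if j ≤ n then B y (e j) else if j = n + 1 then B y c else 0 := by
      intro y
      split_ifs
      · simp [hRr _ (hρR j)]
      · rfl
      · exact hRr r hr y
    simp only [hj']
    by_cases hi1 : i ≤ n
    · simp only [if_pos hi1]
      by_cases hj1 : j ≤ n
      · rw [if_pos hj1, map_sub, LinearMap.sub_apply, hRe _ (hρR i), sub_zero, gram i j hi1 hj1]
      · rw [if_neg hj1, if_neg (show i ≠ j + 1 by omega)]
        split_ifs with hj2
        · rcases i with - | - | i
          · exact hρ0 0 rfl c
          · omega
          · rw [hρs (i + 2) i rfl hi1, hc i (by omega), if_neg (by omega)]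
        · rfl
    · by_cases hi2 : i = n + 1
      · simp only [if_neg hi1, if_pos hi2]
        split_ifs with h1 h2 h2 h3 h3
        · rw [hc j h1, if_pos (by omega)]
        · rw [hc j h1, if_neg (by omega)]
        · omega
        · rcases n with - | n
          · omega
          · rw [hcs n rfl, hc n (by omega), if_neg (by omega)]
        · omega
        · rfl
      · simp only [if_neg hi1, if_neg hi2]
        split_ifs with h1 h2 h2 h3 h3
        · omega
        · exact hRe r hr j
        · rw [hrB, hc n le_rfl, if_pos rfl]
        · omega
        · omega
        · rfl
  · simp only [zero_le, if_true]
    intro h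
    exact notMem (sub_eq_zero.1 h ▸ hρR 0)

theorem exists_isNilpotentChain.{u, v} {F : Type u} [Field F] {V : Type v} [AddCommGroup V]
    [Module F V] [FiniteDimensional F V] (B : V →ₗ[F] V →ₗ[F] F) (x : V) (hx : x ≠ 0)
    (hBx : ∀ y, B x y = 0) : ∃ n e, IsNilpotentChain B n e := by
  induction hn : Module.finrank F V using Nat.strong_induction_on generalizing V with
  | _ n ih =>
  by_cases hz : ∃ z ≠ 0, ∀ y, B z y = 0 ∧ B y z = 0
  · obtain ⟨z, hz, hBz⟩ := hz
    refine ⟨0, fun _ => z, fun y => (hBz y).1, fun y => (hBz y).2, by omega, fun i j hi hj => ?_, hz⟩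
    rw [if_neg (by omega)]
    exact (hBz z).1
  push Not at hz
  by_cases hrl : ∃ r l, (∀ y, B y r = 0) ∧ (∀ y, B l y = 0) ∧ B r l ≠ 0
  · obtain ⟨r, l, hr, hl, hB⟩ := hrl
    refine ⟨1, fun i => if i = 0 then l else (B r l)⁻¹ • r, fun y => by simpa using hl y,
      fun y => by simp [hr], by omega, fun i j hi hj => ?_, ?_⟩
    · have hi : i = 0 ∨ i = 1 := by omega
      have hj : j = 0 ∨ j = 1 := by omega
      rcases hi with rfl | rfl <;> rcases hj with rfl | rfl <;> simp [hr, hl, hB]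
    · rintro h
      simp only [if_true] at h
      simp [h] at hB
  push Not at hrl
  set R := LinearMap.ker B.flip with hR
  have hRr : ∀ r, r ∈ R ↔ ∀ y, B y r = 0 := fun r => by
    rw [hR, LinearMap.mem_ker, LinearMap.ext_iff]
    simp
  have hRne : ∃ r ∈ R, r ≠ 0 := by
    by_contra! h
    obtain ⟨f, hf⟩ := Module.Projective.exists_dual_ne_zero F hx
    have hinj : Function.Injective B.flip := (injective_iff_map_eq_zero _).2 h
    obtain ⟨y, rfl⟩ := (LinearMap.injective_iff_surjective_of_finrank_eq_finrank
      (Subspace.dual_finrank_eq (K := F) (V := V)).symm).1 hinj f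
    exact hf (hBx y)
  let V₁ := LinearMap.ker (B.domRestrict R).flip
  have hV₁ : ∀ y, y ∈ V₁ ↔ ∀ r ∈ R, B r y = 0 := fun y => by
    rw [LinearMap.mem_ker, LinearMap.ext_iff]
    simp
  obtain ⟨Q, hQ⟩ := Submodule.exists_isCompl R
  have hRV : ∀ r ∈ R, r ∈ V₁ := fun r hr => (hV₁ r).2 fun s _ => (hRr r).1 hr s
  have hdec : ∀ y ∈ V₁, ∃ a ∈ R, ∃ b ∈ Q ⊓ V₁, y = a + b := by
    intro y hy
    obtain ⟨a, ha, b, hb, rfl⟩ := Submodule.mem_sup.1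
      (show y ∈ R ⊔ Q by rw [hQ.sup_eq_top]; trivial)
    exact ⟨a, ha, b, ⟨hb, (add_mem_cancel_left (hRV a ha)).1 hy⟩, rfl⟩
  have hRQ : ∀ r ∈ R, r ∈ Q → r = 0 := fun r h1 h2 => Submodule.disjoint_def.1 hQ.disjoint r h1 h2
  have hlt : Module.finrank F ↥(Q ⊓ V₁) < n := by
    rw [← hn]
    apply Submodule.finrank_lt
    intro htop
    obtain ⟨r, hr, hr0⟩ := hRne
    exact hr0 (hRQ r hr (show r ∈ Q ⊓ V₁ from htop ▸ Submodule.mem_top).1)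
  obtain ⟨a, ha, b, hb, hab⟩ := hdec x ((hV₁ x).2 fun r hr => hrl r x ((hRr r).1 hr) hBx)
  have hb0 : b ≠ 0 := by
    rintro rfl
    rw [add_zero] at hab
    obtain ⟨y, hy⟩ := hz x hx
    exact hy (hBx y) ((hRr x).1 (hab ▸ ha) y)
  obtain ⟨k, e, he⟩ := ih _ hlt (B.compl₁₂ (Q ⊓ V₁).subtype (Q ⊓ V₁).subtype) ⟨b, hb⟩
    (by simpa using hb0) (fun y => by
      have h1 := hBx y
      rw [hab, map_add, LinearMap.add_apply, (hV₁ y).1 y.2.2 a ha, zero_add] at h1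
      exact h1) rfl
  have hright : ∀ (v y : V), v ∈ V₁ → y ∈ V₁ → ∃ b : ↥(Q ⊓ V₁), B v y = B v b ∧ B y v = B b v := by
    intro v y hv hy
    obtain ⟨a, ha, b, hb, rfl⟩ := hdec y hy
    exact ⟨⟨b, hb⟩, by simp [(hRr a).1 ha], by simp [(hV₁ v).1 hv a ha]⟩
  refine ⟨_, exists_isNilpotentChain_of_chain_on_orthogonal (n := k) (e := fun i => e i) V₁ hV₁
    (fun i => (e i).2.2) (fun y hy => ?_) (fun y hy => ?_) (fun i hi y hy => ?_)
    (fun i j hi hj => he.gram i j hi hj) fun h => ?_⟩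
  · obtain ⟨b, h1, -⟩ := hright _ y (e 0).2.2 hy
    rw [h1]
    exact he.left b
  · obtain ⟨b, -, h1⟩ := hright _ y (e k).2.2 hy
    rw [h1]
    exact he.right b
  · obtain ⟨a, ha, b, hb, rfl⟩ := hdec y hy
    have h1 : B (e (i + 2)) a = 0 := (hRr a).1 ha _
    have h2 : B a (e i) = 0 := (hV₁ _).1 (e i).2.2 a ha
    rw [map_add, map_add, LinearMap.add_apply, h1, h2, zero_add, zero_add]
    exact he.shift i hi ⟨b, hb⟩
  · exact he.ne_zero (Subtype.ext (hRQ _ h (e 0).2.1))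

end Degenerate

section Asymmetry

theorem exists_asymmetry [FiniteDimensional F V] {B : V →ₗ[F] V →ₗ[F] F}
    (hB : ∀ x, (∀ y, B x y = 0) → x = 0) :
    (∃ T S : Module.End F V, (∀ x, T (S x) = x) ∧ (∀ x, S (T x) = x) ∧ ∀ x y, B x y = B y (T x)) ∧
      ∀ f : Module.Dual F V, ∃ y, ∀ x, B x y = f x := by
  have hfin : Module.finrank F V = Module.finrank F (Module.Dual F V) :=
    (Subspace.dual_finrank_eq (K := F) (V := V)).symm
  have hinj : Function.Injective B := (injective_iff_map_eq_zero _).2 fun x hx =>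
    hB x fun y => LinearMap.congr_fun hx y
  have hsurj := (LinearMap.injective_iff_surjective_of_finrank_eq_finrank hfin).1 hinj
  have hinj' : Function.Injective B.flip := (injective_iff_map_eq_zero _).2 fun y hy => by
    refine (Module.forall_dual_apply_eq_zero_iff F y).1 fun f => ?_
    obtain ⟨x, rfl⟩ := hsurj f
    exact LinearMap.congr_fun hy x
  have hsurj' := (LinearMap.injective_iff_surjective_of_finrank_eq_finrank hfin).1 hinj'
  let E : V ≃ₗ[F] V := (LinearEquiv.ofBijective B ⟨hinj, hsurj⟩).trans
    (LinearEquiv.ofBijective B.flip ⟨hinj', hsurj'⟩).symm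
  refine ⟨⟨E, E.symm, E.apply_symm_apply, E.symm_apply_apply, fun x y => ?_⟩, fun f => ?_⟩
  · have h := (LinearEquiv.ofBijective B.flip ⟨hinj', hsurj'⟩).apply_symm_apply (B x)
    exact (LinearMap.congr_fun h y).symm
  · obtain ⟨y, rfl⟩ := hsurj' f
    exact ⟨y, fun x => rfl⟩

/-- If the asymmetry `T` of `B` acts on vectors with invertible Gram matrix in the same way as the
asymmetry of a matrix `M`, then `M` is the Gram matrix of an orthogonal summand. The action of `T`
is encoded by matrices `D`, `C` with `T e D = e C`. -/
theorem exists_isOrthogonalSummand_of_asymmetry [IsAlgClosed F] (h2 : (2 : F) ≠ 0)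
    {B : V →ₗ[F] V →ₗ[F] F} {T : Module.End F V} (hT : ∀ x y, B x y = B y (T x))
    {ι : Type*} [Fintype ι] [DecidableEq ι] {e : ι → V} {D C M : Matrix ι ι F}
    (hG : IsUnit (Matrix.of fun i j => B (e i) (e j))) (hD : IsUnit D)
    (hDC : ∀ j, ∑ i, D i j • T (e i) = ∑ i, C i j • e i) (hM : IsUnit M)
    (hMDC : Mᵀ * D = M * C) :
    ∃ e' : ι → V, (∀ i j, B (e' i) (e' j) = M i j) ∧ IsOrthogonalSummand B e' := by
  set G : Matrix ι ι F := Matrix.of fun i j => B (e i) (e j) with hGdef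
  have hGDC : Gᵀ * D = G * C := by
    ext k j
    have h := congrArg (B (e k)) (hDC j)
    simp only [map_sum, map_smul, ← hT, smul_eq_mul] at h
    simpa [Matrix.mul_apply, hGdef, mul_comm] using h
  have hDd := (Matrix.isUnit_iff_isUnit_det D).1 hD
  have hGd := (Matrix.isUnit_iff_isUnit_det G).1 hG
  have hMd := (Matrix.isUnit_iff_isUnit_det M).1 hM
  have hcos : Mᵀ = M * G⁻¹ * Gᵀ := by
    have h1 : Gᵀ = G * C * D⁻¹ := by rw [← hGDC, Matrix.mul_nonsing_inv_cancel_right _ _ hDd]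
    rw [h1, Matrix.mul_assoc G, Matrix.mul_assoc M, Matrix.nonsing_inv_mul_cancel_left _ _ hGd,
      ← Matrix.mul_assoc, ← hMDC, Matrix.mul_nonsing_inv_cancel_right _ _ hDd]
  obtain ⟨P, hP, hPG⟩ := exists_congr_of_cosquare_eq h2 hG hM hcos
  have hgram : ∀ i j, B (∑ k, P k i • e k) (∑ k, P k j • e k) = M i j := by
    intro i j
    rw [← hPG]
    simp only [map_sum, map_smul, LinearMap.sum_apply, LinearMap.smul_apply, smul_eq_mul,
      Matrix.mul_apply, Matrix.transpose_apply, hGdef, Matrix.of_apply, Finset.mul_sum,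
      Finset.sum_mul]
    exact Finset.sum_congr rfl fun k _ => Finset.sum_congr rfl fun l _ => by ring
  have eq_zero_of_sum : ∀ {A : Matrix ι ι F} {g : ι → F}, IsUnit A →
      (∀ i, ∑ k, A i k * g k = 0) → ∀ k, g k = 0 := by
    intro A g hA h k
    have h0 : A *ᵥ g = A *ᵥ 0 := by
      ext i
      simpa [Matrix.mulVec, dotProduct] using h i
    exact congrFun (Matrix.mulVec_injective_iff_isUnit.2 hA h0) k
  refine ⟨fun j => ∑ k, P k j • e k, hgram,
    fun i => ∑ k, (Mᵀ)⁻¹ i k • B.flip (∑ l, P l k • e l), fun i j => ?_, fun w hw => ?_⟩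
  · have h1 : (Mᵀ)⁻¹ * Mᵀ = 1 := Matrix.nonsing_inv_mul _ (by rwa [Matrix.det_transpose])
    have h2 := congrFun (congrFun h1 i) j
    rw [Matrix.one_apply, Matrix.mul_apply] at h2
    rw [← h2]
    simp only [LinearMap.sum_apply, LinearMap.smul_apply, LinearMap.flip_apply, hgram,
      Matrix.transpose_apply, smul_eq_mul]
  · have hwe' : ∀ k, B w (∑ l, P l k • e l) = 0 :=
      eq_zero_of_sum (A := (Mᵀ)⁻¹)
        (by rw [Matrix.isUnit_nonsing_inv_iff, Matrix.isUnit_transpose]; exact hM)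
        fun i => by
          simpa only [LinearMap.sum_apply, LinearMap.smul_apply, LinearMap.flip_apply,
            smul_eq_mul] using hw i
    have hwe : ∀ k, B w (e k) = 0 :=
      eq_zero_of_sum (A := Pᵀ) ((Matrix.isUnit_transpose P).2 hP) fun i => by
        simpa only [map_sum, map_smul, smul_eq_mul, Matrix.transpose_apply] using hwe' i
    have hew : ∀ k, B (e k) w = 0 :=
      eq_zero_of_sum (A := Dᵀ) ((Matrix.isUnit_transpose D).2 hD) fun j => by
        have h := congrArg (B w) (hDC j)
        simp only [map_sum, map_smul, ← hT, smul_eq_mul, hwe, mul_zero,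
          Finset.sum_const_zero] at h
        exact h
    exact fun i => ⟨by simp [LinearMap.sum_apply, hew], hwe' i⟩

theorem eq_zero_of_recurrence {f : ℕ → ℕ → F} {lam : F} {n : ℕ} (hlam : lam ^ 2 ≠ 1)
    (hrec : ∀ i j, f (i + 1) (j + 1) + lam * (f (i + 1) j + f i (j + 1)) +
      (lam ^ 2 - 1) * f i j = 0)
    (hleft : ∀ i j, n < i → f i j = 0) (hright : ∀ i j, n < j → f i j = 0) (i j : ℕ) :
    f i j = 0 := by
  have key : ∀ k i j, 2 * n < i + j + k → f i j = 0 := by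
    intro k
    induction k with
    | zero =>
      intro i j h
      rcases lt_or_ge n i with hi | hi
      · exact hleft i j hi
      · exact hright i j (by omega)
    | succ k ih =>
      intro i j h
      have h1 := hrec i j
      rw [ih _ _ (by omega), ih (i + 1) j (by omega), ih i (j + 1) (by omega)] at h1
      simpa [sub_eq_zero, hlam] using h1
  exact key (2 * n + 1) i j (by omega)

theorem eq_neg_one_pow_mul_of_recurrence {f : ℕ → ℕ → F} {lam : F} {s : ℕ} (hlam : lam ^ 2 = 1)
    (hrec : ∀ i j, f (i + 1) (j + 1) + lam * (f (i + 1) j + f i (j + 1)) +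
      (lam ^ 2 - 1) * f i j = 0)
    (hs : ∀ i j, s < i + j → f i j = 0) (i j : ℕ) (hij : i + j = s) :
    f i j = (-1) ^ j * f s 0 := by
  have hlam0 : lam ≠ 0 := by
    rintro rfl
    simp at hlam
  induction j generalizing i with
  | zero => simp [show i = s by omega]
  | succ j ih =>
    have h1 := hrec i j
    rw [hs _ _ (by omega), hlam, ih (i + 1) (by omega)] at h1
    simp only [zero_add, sub_self, zero_mul, add_zero, mul_eq_zero, hlam0, false_or] at h1
    rw [pow_succ]
    linear_combination h1

theorem eq_zero_of_recurrence_of_lt {f : ℕ → ℕ → F} {lam : F} {n : ℕ} (hlam : lam ^ 2 = 1)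
    (hrec : ∀ i j, f (i + 1) (j + 1) + lam * (f (i + 1) j + f i (j + 1)) +
      (lam ^ 2 - 1) * f i j = 0)
    (hleft : ∀ i j, n < i → f i j = 0) (hright : ∀ i j, n < j → f i j = 0) (i j : ℕ)
    (hij : n < i + j) : f i j = 0 := by
  have key : ∀ k i j, 2 * n < i + j + k → n < i + j → f i j = 0 := by
    intro k
    induction k with
    | zero =>
      intro i j h _
      rcases lt_or_ge n i with hi | hi
      · exact hleft i j hi
      · exact hright i j (by omega)
    | succ k ih =>
      intro i j h hn
      rw [eq_neg_one_pow_mul_of_recurrence hlam hrec (fun a b hab => ih a b (by omega) (by omega))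
        i j rfl, hleft _ _ hn, mul_zero]
  exact key (2 * n + 1) i j (by omega) hij

variable {B : V →ₗ[F] V →ₗ[F] F} {T : Module.End F V}

theorem asymmetry_recurrence (hT : ∀ x y, B x y = B y (T x)) (lam : F) (u v : V) (i j : ℕ) :
    B (((T - algebraMap F _ lam) ^ (i + 1)) u) (((T - algebraMap F _ lam) ^ (j + 1)) v) +
      lam * (B (((T - algebraMap F _ lam) ^ (i + 1)) u) (((T - algebraMap F _ lam) ^ j) v) +
        B (((T - algebraMap F _ lam) ^ i) u) (((T - algebraMap F _ lam) ^ (j + 1)) v)) +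
      (lam ^ 2 - 1) *
        B (((T - algebraMap F _ lam) ^ i) u) (((T - algebraMap F _ lam) ^ j) v) = 0 := by
  simp only [pow_succ', Module.End.mul_apply]
  generalize ((T - algebraMap F _ lam) ^ i) u = u
  generalize ((T - algebraMap F _ lam) ^ j) v = v
  have h : B (T u) (T v) = B u v := by rw [← hT v, ← hT u]
  simp only [LinearMap.sub_apply, Module.algebraMap_end_apply, map_sub, map_smul,
    LinearMap.smul_apply, smul_eq_mul]
  linear_combination h

theorem pow_apply_eq_zero_of_lt {N : Module.End F V} {n : ℕ} {u : V} (hu : (N ^ (n + 1)) u = 0)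
    {i : ℕ} (hi : n < i) : (N ^ i) u = 0 :=
  Module.End.pow_map_zero_of_le hi hu

theorem apply_pow_pow_eq_zero_of_lt (hT : ∀ x y, B x y = B y (T x)) {lam : F} (hlam : lam ^ 2 = 1)
    {n : ℕ} {u v : V} (hu : ((T - algebraMap F _ lam) ^ (n + 1)) u = 0)
    (hv : ((T - algebraMap F _ lam) ^ (n + 1)) v = 0) {i j : ℕ} (hij : n < i + j) :
    B (((T - algebraMap F _ lam) ^ i) u) (((T - algebraMap F _ lam) ^ j) v) = 0 :=
  eq_zero_of_recurrence_of_lt (f := fun i j => B (((T - algebraMap F _ lam) ^ i) u)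
    (((T - algebraMap F _ lam) ^ j) v)) hlam (fun i j => asymmetry_recurrence hT lam u v i j)
    (fun i j hi => by rw [pow_apply_eq_zero_of_lt hu hi, map_zero, LinearMap.zero_apply])
    (fun i j hj => by rw [pow_apply_eq_zero_of_lt hv hj, map_zero]) i j hij

theorem apply_pow_pow_eq (hT : ∀ x y, B x y = B y (T x)) {lam : F} (hlam : lam ^ 2 = 1)
    {n : ℕ} {u v : V} (hu : ((T - algebraMap F _ lam) ^ (n + 1)) u = 0)
    (hv : ((T - algebraMap F _ lam) ^ (n + 1)) v = 0) {i j : ℕ} (hij : i + j = n) :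
    B (((T - algebraMap F _ lam) ^ i) u) (((T - algebraMap F _ lam) ^ j) v) =
      (-1) ^ j * B (((T - algebraMap F _ lam) ^ n) u) v :=
  eq_neg_one_pow_mul_of_recurrence (f := fun i j => B (((T - algebraMap F _ lam) ^ i) u)
    (((T - algebraMap F _ lam) ^ j) v)) hlam (fun i j => asymmetry_recurrence hT lam u v i j)
    (fun _ _ h => apply_pow_pow_eq_zero_of_lt hT hlam hu hv h) i j hij

theorem apply_pow_comm (hT : ∀ x y, B x y = B y (T x)) {lam : F} (hlam : lam ^ 2 = 1)
    {n : ℕ} {u v : V} (hu : ((T - algebraMap F _ lam) ^ (n + 1)) u = 0)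
    (hv : ((T - algebraMap F _ lam) ^ (n + 1)) v = 0) :
    B (((T - algebraMap F _ lam) ^ n) u) v =
      lam * (-1) ^ n * B (((T - algebraMap F _ lam) ^ n) v) u := by
  have h := apply_pow_pow_eq hT hlam hv hu (zero_add n)
  rw [pow_zero, Module.End.one_apply] at h
  rw [mul_assoc, ← h, hT]
  rw [pow_succ', Module.End.mul_apply, LinearMap.sub_apply, sub_eq_zero] at hu
  rw [hu, Module.algebraMap_end_apply, map_smul, smul_eq_mul]

theorem apply_pow_pow_eq_zero_of_le (h2 : (2 : F) ≠ 0) (hT : ∀ x y, B x y = B y (T x)) {lam : F}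
    {n : ℕ} (hlam : lam ≠ (-1) ^ n) {u : V} (hu : ((T - algebraMap F _ lam) ^ (n + 1)) u = 0)
    {i j : ℕ} (hij : n ≤ i + j) :
    B (((T - algebraMap F _ lam) ^ i) u) (((T - algebraMap F _ lam) ^ j) u) = 0 := by
  by_cases hl : lam ^ 2 = 1
  · rcases hij.lt_or_eq with hij | rfl
    · exact apply_pow_pow_eq_zero_of_lt hT hl hu hu hij
    · rw [apply_pow_pow_eq hT hl hu hu rfl]
      have h1 : lam * (-1) ^ (i + j) = -1 := by
        have h3 : ((-1 : F) ^ (i + j)) ^ 2 = 1 := by rw [← pow_mul, mul_comm, pow_mul]; simp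
        have h4 : (lam - (-1) ^ (i + j)) * (lam + (-1) ^ (i + j)) = 0 := by
          linear_combination hl - h3
        rcases mul_eq_zero.1 h4 with h | h
        · exact absurd (sub_eq_zero.1 h) hlam
        · linear_combination (-1) ^ (i + j) * h - h3
      have h5 := apply_pow_comm hT hl hu hu
      rw [h1] at h5
      have h6 : (2 : F) * B (((T - algebraMap F _ lam) ^ (i + j)) u) u = 0 := by
        linear_combination h5
      rw [(mul_eq_zero.1 h6).resolve_left h2, mul_zero]
  · exact eq_zero_of_recurrence (f := fun i j => B (((T - algebraMap F _ lam) ^ i) u)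
      (((T - algebraMap F _ lam) ^ j) u)) hl (fun i j => asymmetry_recurrence hT lam u u i j)
      (fun i j hi => by rw [pow_apply_eq_zero_of_lt hu hi, map_zero, LinearMap.zero_apply])
      (fun i j hj => by rw [pow_apply_eq_zero_of_lt hu hj, map_zero]) i j

theorem sum_ite_val_eq_smul {n j : ℕ} (hj : j < n) (c : F) (g : ℕ → V) :
    ∑ i : Fin n, (if (i : ℕ) = j then c else 0) • g i = c • g j := by
  rw [Finset.sum_eq_single ⟨j, hj⟩]
  · simp
  · intro i _ hi
    rw [if_neg (fun h => hi (Fin.ext h)), zero_smul]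
  · simp

theorem sum_ite_val_succ_eq_smul {n j : ℕ} (hj : j < n) (c : F) (g : ℕ → V) :
    ∑ i : Fin n, (if (i : ℕ) + 1 = j then c else 0) • g i =
      if j = 0 then 0 else c • g (j - 1) := by
  rcases j with - | j
  · simp
  · simpa using sum_ite_val_eq_smul (by omega) c g

theorem jordanBlock_eq_add (m : ℕ) (lam : F) (i j : Fin m) :
    jordanBlock m lam i j =
      (if (i : ℕ) = j then lam else 0) + if (i : ℕ) = j + 1 then 1 else 0 := by
  rw [jordanBlock, Matrix.of_apply]
  split_ifs <;> first | omega | simp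

theorem sum_jordanBlock_smul {m : ℕ} (lam : F) {g : ℕ → V} (hg : g m = 0) (j : Fin m) :
    ∑ i, jordanBlock m lam i j • g i = lam • g j + g (j + 1) := by
  simp only [jordanBlock_eq_add, add_smul, Finset.sum_add_distrib]
  rw [sum_ite_val_eq_smul j.2]
  congr 1
  rcases lt_or_ge ((j : ℕ) + 1) m with h | h
  · rw [sum_ite_val_eq_smul h, one_smul]
  · rw [show (j : ℕ) + 1 = m by omega, hg]
    exact Finset.sum_eq_zero fun i _ => by rw [if_neg (by omega), zero_smul]

theorem sum_jordanBlock_transpose_smul {m : ℕ} (lam : F) (g : ℕ → V) (j : Fin m) :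
    ∑ i, (jordanBlock m lam)ᵀ i j • g i =
      lam • g j + if (j : ℕ) = 0 then 0 else g (j - 1) := by
  simp only [Matrix.transpose_apply, jordanBlock_eq_add, add_smul, Finset.sum_add_distrib,
    eq_comm (a := (j : ℕ)) (b := Fin.val _), eq_comm (a := (j : ℕ)) (b := Fin.val _ + 1)]
  rw [sum_ite_val_eq_smul j.2, sum_ite_val_succ_eq_smul j.2, one_smul]

theorem isUnit_jordanBlock {m : ℕ} {lam : F} (hlam : lam ≠ 0) : IsUnit (jordanBlock m lam) := by
  rw [Matrix.isUnit_iff_isUnit_det, Matrix.det_of_isLowerTriangular]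
  · simp [jordanBlock, hlam]
  · intro i j hij
    have hij : (i : ℕ) < j := hij
    rw [jordanBlock, Matrix.of_apply, if_neg (by omega), if_neg (by omega)]

theorem isUnit_of_antitriangular {n : ℕ} {M : Matrix (Fin (n + 1)) (Fin (n + 1)) F}
    (hlt : ∀ i j : Fin (n + 1), (i : ℕ) + j < n → M i j = 0)
    (heq : ∀ i j : Fin (n + 1), (i : ℕ) + j = n → M i j ≠ 0) : IsUnit M := by
  rw [← Matrix.isUnit_submatrix_equiv Fin.revPerm (Equiv.refl _), Matrix.isUnit_iff_isUnit_det,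
    Matrix.det_of_isUpperTriangular]
  · rw [isUnit_iff_ne_zero, Finset.prod_ne_zero_iff]
    intro i _
    exact heq _ _ (by simp [Fin.val_rev]; omega)
  · intro i j hij
    have hij : (j : ℕ) < i := hij
    exact hlt _ _ (by simp [Fin.val_rev]; omega)

theorem adjoint_sub_pow {S : Module.End F V} (hS : ∀ x y, B (T x) y = B x (S y)) (lam : F)
    (i : ℕ) (x y : V) :
    B (((T - algebraMap F _ lam) ^ i) x) y = B x (((S - algebraMap F _ lam) ^ i) y) := by
  induction i generalizing x with
  | zero => rfl
  | succ i ih =>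
    rw [pow_succ, Module.End.mul_apply, ih, pow_succ', Module.End.mul_apply]
    simp [hS]

/-- The Gram matrix of two chains that are isotropic up to order `n` and paired by `B`. -/
theorem isUnit_gram_of_paired_chains {n : ℕ} {X Y : ℕ → V} {c c' : F} (hc : c ≠ 0) (hc' : c' ≠ 0)
    (hXX : ∀ i j, n ≤ i + j → B (X i) (X j) = 0) (hYY : ∀ i j, n ≤ i + j → B (Y i) (Y j) = 0)
    (hXY : ∀ i j, i + j = n → B (X i) (Y j) = c) (hXY' : ∀ i j, n < i + j → B (X i) (Y j) = 0)
    (hYX : ∀ i j, i + j = n → B (Y i) (X j) = c') (hYX' : ∀ i j, n < i + j → B (Y i) (X j) = 0)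
    {e : Fin (n + 1) ⊕ Fin (n + 1) → V} (hl : ∀ i, e (Sum.inl i) = Y i)
    (hr : ∀ i, e (Sum.inr i) = X (n - i)) :
    IsUnit (Matrix.of fun i j => B (e i) (e j)) := by
  rw [← Matrix.mulVec_injective_iff_isUnit, ← Matrix.coe_mulVecLin, injective_iff_map_eq_zero]
  intro a ha
  have hz : ∀ p, ∑ j, a (Sum.inl j) * B (e p) (Y j) +
      ∑ j : Fin (n + 1), a (Sum.inr j) * B (e p) (X (n - j)) = 0 := by
    intro p
    have h := congrFun ha p
    simpa [Matrix.mulVec, dotProduct, Fintype.sum_sum_type, hl, hr, mul_comm] using h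
  have key : ∀ k, ∀ j : Fin (n + 1),
      ((j : ℕ) = k → a (Sum.inl j) = 0) ∧ (n - (j : ℕ) = k → a (Sum.inr j) = 0) := by
    intro k
    induction k using Nat.strong_induction_on with
    | _ k ih =>
    intro j
    constructor
    · intro hj
      have h := hz (Sum.inr j)
      rw [hr, Finset.sum_eq_single j, Finset.sum_eq_zero, add_zero, hXY _ _ (by omega)] at h
      · exact (mul_eq_zero.1 h).resolve_right hc
      · intro i _
        rcases lt_or_ge (n - (i : ℕ)) k with hi | hi
        · rw [(ih _ hi i).2 rfl, zero_mul]
        · rw [hXX _ _ (by omega), mul_zero]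
      · intro i _ hi
        have hi : (i : ℕ) ≠ j := fun h => hi (Fin.ext h)
        rcases lt_or_ge (i : ℕ) k with hi' | hi'
        · rw [(ih _ hi' i).1 rfl, zero_mul]
        · rw [hXY' _ _ (by omega), mul_zero]
      · simp
    · intro hj
      have h := hz (Sum.inl j)
      rw [hl, Finset.sum_eq_zero, zero_add, Finset.sum_eq_single j, hYX _ _ (by omega)] at h
      · exact (mul_eq_zero.1 h).resolve_right hc'
      · intro i _ hi
        have hi : (i : ℕ) ≠ j := fun h => hi (Fin.ext h)
        rcases lt_or_ge (n - (i : ℕ)) k with hi' | hi'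
        · rw [(ih _ hi' i).2 rfl, zero_mul]
        · rw [hYX' _ _ (by omega), mul_zero]
      · simp
      · intro i _
        rcases lt_or_ge (i : ℕ) k with hi' | hi'
        · rw [(ih _ hi' i).1 rfl, zero_mul]
        · rw [hYY _ _ (by omega), mul_zero]
  ext (j | j)
  · exact (key _ j).1 rfl
  · exact (key _ j).2 rfl

theorem hasCanonicalSummand_of_ne_neg_one_pow [IsAlgClosed F] (h2 : (2 : F) ≠ 0)
    (hT : ∀ x y, B x y = B y (T x)) {S : Module.End F V} (hTS : ∀ x, T (S x) = x) {lam : F}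
    (hlam0 : lam ≠ 0) {n : ℕ} (hlam : lam ≠ (-1) ^ n) {x y : V}
    (hx : ((T - algebraMap F _ lam) ^ (n + 1)) x = 0)
    (hy : ((S - algebraMap F _ lam) ^ (n + 1)) y = 0)
    (hxy : B (((T - algebraMap F _ lam) ^ n) x) y ≠ 0) : HasCanonicalSummand B := by
  have hS : ∀ x y, B.flip x y = B.flip y (S x) := fun x y => by
    rw [LinearMap.flip_apply, LinearMap.flip_apply, hT (S x), hTS]
  have hadj : ∀ x y, B (T x) y = B x (S y) := fun x y => by rw [hT x, hT (S y), hTS]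
  have hadj' : ∀ x y, B (S x) y = B x (T y) := fun x y => by rw [hT (S x), hTS, ← hT]
  set N := T - algebraMap F _ lam with hN
  set N' := S - algebraMap F _ lam with hN'
  have hTN : ∀ v, T v = lam • v + N v := fun v => by simp [hN]
  have hSN : ∀ v, S v = lam • v + N' v := fun v => by simp [hN']
  have hpow : ∀ (A : Module.End F V) i j v, (A ^ i) ((A ^ j) v) = (A ^ (i + j)) v :=
    fun A i j v => by rw [pow_add, Module.End.mul_apply]
  have hsucc : ∀ (A : Module.End F V) i v, A ((A ^ i) v) = (A ^ (i + 1)) v :=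
    fun A i v => by rw [pow_succ', Module.End.mul_apply]
  have hXY : ∀ i j, B ((N ^ i) x) ((N' ^ j) y) = B ((N ^ (i + j)) x) y := fun i j => by
    rw [← adjoint_sub_pow hadj, ← hN, hpow, add_comm]
  have hYX : ∀ i j, B ((N' ^ i) y) ((N ^ j) x) = B y ((N ^ (i + j)) x) := fun i j => by
    rw [adjoint_sub_pow hadj', ← hN, hpow]
  have hc' : B y ((N ^ n) x) = lam⁻¹ * B ((N ^ n) x) y := by
    rw [hT _ y, hTN, hsucc, hx, add_zero, map_smul, smul_eq_mul, inv_mul_cancel_left₀ hlam0]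
  let e : Fin (n + 1) ⊕ Fin (n + 1) → V :=
    Sum.elim (fun j => (N' ^ (j : ℕ)) y) fun i => (N ^ (n - i)) x
  have hgram : IsUnit (Matrix.of fun i j => B (e i) (e j)) :=
    isUnit_gram_of_paired_chains (X := fun i => (N ^ i) x) (Y := fun j => (N' ^ j) y) hxy
      (mul_ne_zero (inv_ne_zero hlam0) hxy)
      (fun i j hij => apply_pow_pow_eq_zero_of_le h2 hT hlam hx hij)
      (fun i j hij => apply_pow_pow_eq_zero_of_le h2 hS hlam hy ((add_comm i j) ▸ hij))
      (fun i j hij => by rw [hXY, hij])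
      (fun i j hij => by rw [hXY, pow_apply_eq_zero_of_lt hx hij, map_zero, LinearMap.zero_apply])
      (fun i j hij => by rw [hYX, hij, hc'])
      (fun i j hij => by rw [hYX, pow_apply_eq_zero_of_lt hx hij, map_zero])
      (fun i => rfl) fun i => rfl
  have hJ := isUnit_jordanBlock (m := n + 1) hlam0
  have hJd : IsUnit (fromBlocks (jordanBlock (n + 1) lam) 0 0
      (1 : Matrix (Fin (n + 1)) (Fin (n + 1)) F)) := by
    rw [Matrix.isUnit_fromBlocks_zero₂₁]
    exact ⟨hJ, isUnit_one⟩
  have hM : IsUnit (fromBlocks 0 (1 : Matrix (Fin (n + 1)) (Fin (n + 1)) F)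
      (jordanBlock (n + 1) lam) 0) := by
    rw [← isUnit_pow_iff two_ne_zero, pow_two, Matrix.fromBlocks_multiply]
    simpa [Matrix.isUnit_fromBlocks_zero₂₁] using hJ
  have hTe : ∀ j, ∑ i, fromBlocks (jordanBlock (n + 1) lam) 0 0 1 i j • T (e i) =
      ∑ i, fromBlocks 1 0 0 (jordanBlock (n + 1) lam)ᵀ i j • e i := by
    rintro (j | j)
    · simp only [Fintype.sum_sum_type, fromBlocks_apply₁₁, fromBlocks_apply₂₁, Matrix.zero_apply,
        zero_smul, Finset.sum_const_zero, add_zero, Matrix.one_apply, ite_smul, one_smul,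
        Finset.sum_ite_eq', Finset.mem_univ, if_true, e, Sum.elim_inl]
      rw [sum_jordanBlock_smul (g := fun i => T ((N' ^ i) y)) lam (by rw [hy, map_zero]),
        ← map_smul, ← map_add, ← hsucc, ← hSN, hTS]
    · simp only [Fintype.sum_sum_type, fromBlocks_apply₁₂, fromBlocks_apply₂₂, Matrix.zero_apply,
        zero_smul, Finset.sum_const_zero, zero_add, Matrix.one_apply, ite_smul, one_smul,
        Finset.sum_ite_eq', Finset.mem_univ, if_true, e, Sum.elim_inr]
      rw [sum_jordanBlock_transpose_smul (g := fun i => (N ^ (n - i)) x), hTN, hsucc]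
      congr 1
      split_ifs with h
      · rw [h, Nat.sub_zero, hx]
      · congr 2
        omega
  obtain ⟨e', hB, he'⟩ := exists_isOrthogonalSummand_of_asymmetry h2 hT hgram hJd hTe hM
    (by simp [Matrix.fromBlocks_transpose, Matrix.fromBlocks_multiply])
  exact hasCanonicalSummand_of_skewSum n.succ_pos (by simpa [pow_succ] using hlam) hB he'

/-- The matrix with `a` on the diagonal and `b` on the superdiagonal. -/
def bidiagonal (n : ℕ) (a b : F) : Matrix (Fin n) (Fin n) F :=
  Matrix.of fun i j => (if (i : ℕ) = j then a else 0) + if (i : ℕ) + 1 = j then b else 0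

theorem sum_bidiagonal_smul {n : ℕ} (a b : F) (g : ℕ → V) (j : Fin n) :
    ∑ i, bidiagonal n a b i j • g i = a • g j + if (j : ℕ) = 0 then 0 else b • g (j - 1) := by
  simp only [bidiagonal, Matrix.of_apply, add_smul, Finset.sum_add_distrib]
  rw [sum_ite_val_eq_smul j.2, sum_ite_val_succ_eq_smul j.2]

theorem isUnit_bidiagonal_one (n : ℕ) (b : F) : IsUnit (bidiagonal n 1 b) := by
  rw [Matrix.isUnit_iff_isUnit_det, Matrix.det_of_isUpperTriangular]
  · simp [bidiagonal]
  · intro i j hij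
    have hij : (j : ℕ) < i := hij
    rw [bidiagonal, Matrix.of_apply, if_neg (by omega), if_neg (by omega), add_zero]

theorem isUnit_gam (n : ℕ) : IsUnit (Gam (n + 1) : Matrix _ _ F) := by
  refine isUnit_of_antitriangular (fun i j hij => ?_) fun i j hij => ?_
  · rw [Gam, Matrix.of_apply, if_neg (by omega)]
  · rw [Gam, Matrix.of_apply, if_pos (by omega)]
    simp

theorem gam_transpose_mul_bidiagonal (n : ℕ) :
    (Gam (n + 1) : Matrix _ _ F)ᵀ * bidiagonal (n + 1) 1 1 =
      Gam (n + 1) * bidiagonal (n + 1) ((-1) ^ n) (-(-1) ^ n) := by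
  let g : ℕ → ℕ → F := fun i j => if i + j = n ∨ i + j = n + 1 then (-1) ^ (n - i) else 0
  have hg : ∀ i j : Fin (n + 1), (Gam (n + 1) : Matrix _ _ F) i j = g i j := fun i j => rfl
  ext k j
  rw [Matrix.mul_apply, Matrix.mul_apply]
  have h1 := sum_bidiagonal_smul (1 : F) 1 (fun i => g i k) j
  have h2 := sum_bidiagonal_smul ((-1 : F) ^ n) (-(-1) ^ n) (fun i => g k i) j
  simp only [smul_eq_mul, mul_comm (bidiagonal _ _ _ _ _)] at h1 h2
  simp only [Matrix.transpose_apply, hg, h1, h2]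
  have hk := k.2
  have hj := j.2
  obtain ⟨d, hd⟩ : ∃ d, n = k + d := ⟨n - k, by omega⟩
  have hsq' : (-1 : F) ^ d * (-1) ^ d = 1 := by rw [← mul_pow]; simp
  have hkd : (-1 : F) ^ n * (-1) ^ (n - (k : ℕ)) = (-1) ^ (k : ℕ) := by
    rw [show n - (k : ℕ) = d by omega, show (-1 : F) ^ n = (-1) ^ (k + d : ℕ) by rw [← hd], pow_add,
      mul_assoc, hsq', mul_one]
  by_cases hj0 : (j : ℕ) = 0
  · simp only [hj0, if_true, add_zero, one_mul, g, zero_add]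
    by_cases hkn : (k : ℕ) = n
    · simp [hkn]
    · rw [if_neg (by omega), if_neg (by omega), mul_zero]
  · rw [if_neg hj0, if_neg hj0]
    simp only [g, one_mul]
    rcases lt_trichotomy ((k : ℕ) + j) (n + 1) with h | h | h
    · rw [if_neg (show ¬ ((j : ℕ) - 1 + k = n ∨ (j : ℕ) - 1 + k = n + 1) by omega),
        if_neg (show ¬ ((k : ℕ) + (j - 1) = n ∨ (k : ℕ) + (j - 1) = n + 1) by omega)]
      by_cases hkj : (k : ℕ) + j = n
      · rw [if_pos (by omega), if_pos (by omega), hkd, show n - (j : ℕ) = k by omega]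
        simp
      · rw [if_neg (by omega), if_neg (by omega)]
        simp
    · rw [if_pos (by omega), if_pos (by omega), if_pos (by omega), if_pos (by omega),
        show n - ((j : ℕ) - 1) = n - j + 1 by omega]
      ring
    · rw [if_neg (show ¬ ((j : ℕ) + k = n ∨ (j : ℕ) + k = n + 1) by omega),
        if_neg (show ¬ ((k : ℕ) + j = n ∨ (k : ℕ) + j = n + 1) by omega)]
      by_cases hkj : (k : ℕ) + j = n + 2
      · rw [if_pos (by omega), if_pos (by omega), neg_mul, hkd,
          show (k : ℕ) = n - (j - 1) + 1 by omega]
        ring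
      · rw [if_neg (by omega), if_neg (by omega)]
        simp

theorem hasCanonicalSummand_of_eq_neg_one_pow [IsAlgClosed F] (h2 : (2 : F) ≠ 0)
    (hT : ∀ x y, B x y = B y (T x)) {n : ℕ} {w : V}
    (hw : ((T - algebraMap F _ ((-1) ^ n)) ^ (n + 1)) w = 0)
    (hww : B (((T - algebraMap F _ ((-1) ^ n)) ^ n) w) w ≠ 0) : HasCanonicalSummand B := by
  set lam : F := (-1) ^ n with hlam
  have hlam2 : lam ^ 2 = 1 := by rw [hlam, ← pow_mul, mul_comm, pow_mul]; simp
  have hlam0 : lam ≠ 0 := by rw [hlam]; exact pow_ne_zero _ (neg_ne_zero.2 one_ne_zero)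
  set N := T - algebraMap F _ lam with hN
  set P := T + algebraMap F _ lam with hP
  have hPN : ∀ v, P v = (2 * lam) • v + N v := fun v => by
    simp only [hP, hN, LinearMap.add_apply, LinearMap.sub_apply, Module.algebraMap_end_apply]
    module
  have hcomm : Commute P N := by
    rw [hP, hN]
    exact ((Commute.refl T).add_left (Algebra.commutes lam T)).sub_right
      (Algebra.commutes lam _).symm
  have hPNpow : ∀ i j v, (P ^ i) ((N ^ j) v) = (N ^ j) ((P ^ i) v) := fun i j v => by
    rw [← Module.End.mul_apply, (hcomm.pow_pow i j).eq, Module.End.mul_apply]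
  have hker : ∀ i, (N ^ (n + 1)) ((P ^ i) w) = 0 := fun i => by rw [← hPNpow, hw, map_zero]
  have hP_right : ∀ u v, (N ^ (n + 1)) u = 0 → (N ^ (n + 1)) v = 0 →
      B ((N ^ n) u) (P v) = 2 * lam * B ((N ^ n) u) v := fun u v hu hv => by
    have h := apply_pow_pow_eq_zero_of_lt hT hlam2 hu hv (lt_add_one n)
    rw [pow_one] at h
    rw [hPN, map_add, map_smul, h, add_zero, smul_eq_mul]
  have hP_left : ∀ u v, (N ^ (n + 1)) u = 0 →
      B ((N ^ n) (P u)) v = 2 * lam * B ((N ^ n) u) v := fun u v hu => by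
    rw [pow_succ, Module.End.mul_apply] at hu
    rw [hPN, map_add, map_smul, hu, add_zero, map_smul, LinearMap.smul_apply, smul_eq_mul]
  have hPP : ∀ i j, B ((N ^ n) ((P ^ i) w)) ((P ^ j) w) =
      (2 * lam) ^ (i + j) * B ((N ^ n) w) w := by
    intro i j
    induction i with
    | zero =>
      induction j with
      | zero => simp
      | succ j ih =>
        rw [pow_succ' P, Module.End.mul_apply, hP_right _ _ (hker 0) (hker j), ih]
        ring
    | succ i ih =>
      rw [pow_succ' P, Module.End.mul_apply, hP_left _ _ (hker i), ih]
      ring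
  let e : ℕ → V := fun j => (-1 : F) ^ j • (P ^ j) ((N ^ (n - j)) w)
  have hBe : ∀ i j, B (e i) (e j) =
      (-1) ^ i * ((-1) ^ j * B ((N ^ (n - i)) ((P ^ i) w)) ((N ^ (n - j)) ((P ^ j) w))) := by
    intro i j
    simp [e, hPNpow]
    ring
  have hgram : IsUnit (Matrix.of fun i j : Fin (n + 1) => B (e i) (e j)) := by
    refine isUnit_of_antitriangular (fun i j hij => ?_) fun i j hij => ?_
    · rw [Matrix.of_apply, hBe,
        apply_pow_pow_eq_zero_of_lt hT hlam2 (hker i) (hker j) (by omega), mul_zero, mul_zero]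
    · rw [Matrix.of_apply, hBe, apply_pow_pow_eq hT hlam2 (hker i) (hker j) (by omega), hPP]
      have hneg : ∀ k, (-1 : F) ^ k ≠ 0 := fun k => pow_ne_zero _ (neg_ne_zero.2 one_ne_zero)
      exact mul_ne_zero (hneg _) (mul_ne_zero (hneg _) (mul_ne_zero (hneg _)
        (mul_ne_zero (pow_ne_zero _ (mul_ne_zero h2 hlam0)) hww)))
  have hTe : ∀ j : Fin (n + 1), ∑ i, bidiagonal (n + 1) (1 : F) 1 i j • T (e i) =
      ∑ i, bidiagonal (n + 1) lam (-lam) i j • e i := by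
    intro j
    rw [sum_bidiagonal_smul (1 : F) 1 (fun i => T (e i)), sum_bidiagonal_smul lam (-lam) e]
    have hTN : ∀ v, T v = lam • v + N v := fun v => by simp [hN]
    have hNe : ∀ j, N (e j) = (-1 : F) ^ j • (P ^ j) ((N ^ (n - j + 1)) w) := fun j => by
      have h := hPNpow j 1 ((N ^ (n - j)) w)
      rw [pow_one] at h
      simp only [e, map_smul]
      rw [← h, pow_succ', Module.End.mul_apply]
    obtain ⟨j, hj⟩ := j
    rcases j with - | j
    · have h0 : N (e 0) = 0 := by
        rw [hNe, Nat.sub_zero, hw, map_zero, smul_zero]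
      simp only [if_true, add_zero, one_smul]
      rw [hTN, h0, add_zero]
    · have h1 : N (e (j + 1)) = -P (e j) := by
        rw [hNe, show n - (j + 1) + 1 = n - j by omega, pow_succ' P, pow_succ',
          Module.End.mul_apply]
        simp [e]
      have hPT : P (e j) = T (e j) + lam • e j := by simp [hP]
      simp only [Nat.add_sub_cancel, if_neg j.succ_ne_zero, one_smul]
      rw [hTN (e (j + 1)), h1, hPT]
      module
  obtain ⟨e', hB, he'⟩ := exists_isOrthogonalSummand_of_asymmetry h2 hT hgram
    (isUnit_bidiagonal_one (n + 1) 1) hTe (isUnit_gam n) (gam_transpose_mul_bidiagonal n)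
  exact ⟨n + 1, Gam (n + 1), e', n.succ_pos, Or.inr (Or.inl rfl), hB, he'⟩

/-- A longest Jordan chain of the asymmetry pairs with a Jordan chain of its inverse. -/
theorem exists_paired_jordan_chains [IsAlgClosed F] [FiniteDimensional F V] [Nontrivial V]
    (hB : ∀ x, (∀ y, B x y = 0) → x = 0) (hsurj : ∀ f : Module.Dual F V, ∃ y, ∀ x, B x y = f x)
    {S : Module.End F V} (hTS : ∀ x, T (S x) = x) (hST : ∀ x, S (T x) = x)
    (hT : ∀ x y, B x y = B y (T x)) :
    ∃ lam : F, lam ≠ 0 ∧ ∃ (n : ℕ) (x y : V),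
      ((T - algebraMap F _ lam) ^ (n + 1)) x = 0 ∧
      ((S - algebraMap F _ lam) ^ (n + 1)) y = 0 ∧
      B (((T - algebraMap F _ lam) ^ n) x) y ≠ 0 := by
  obtain ⟨lam, hlam⟩ := Module.End.exists_eigenvalue T
  obtain ⟨v, hv⟩ := hlam.exists_hasEigenvector
  have hTv : T v = lam • v := hv.apply_eq_smul
  set N := T - algebraMap F _ lam with hN
  have hNv : N v = 0 := by simp [hN, hTv]
  have hex : ∃ k, ∀ u, (N ^ (k + 1)) u = 0 → (N ^ k) u = 0 := by
    refine ⟨Module.finrank F V, fun u hu => ?_⟩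
    rw [← LinearMap.mem_ker] at hu ⊢
    rwa [← Module.End.ker_pow_eq_ker_pow_finrank_of_le (Nat.le_succ _)]
  classical
  obtain ⟨n, hn⟩ : ∃ n, Nat.find hex = n + 1 := Nat.exists_eq_succ_of_ne_zero fun h => by
    have h0 := Nat.find_spec hex
    rw [h] at h0
    exact hv.2 (h0 v (by simpa using hNv))
  have hspec := Nat.find_spec hex
  have hmin := Nat.find_min hex (m := n) (by omega)
  rw [hn] at hspec
  push Not at hmin
  obtain ⟨x, hx, hx0⟩ := hmin
  have hxr : (N ^ n) x ∉ LinearMap.range (N ^ (n + 1)) := by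
    rintro ⟨u, hu⟩
    refine hx0 (hu ▸ hspec u ?_)
    rw [pow_succ', Module.End.mul_apply, hu, ← Module.End.mul_apply, ← pow_succ', hx]
  obtain ⟨f, hf, hfr⟩ := Submodule.exists_le_ker_of_notMem hxr
  obtain ⟨y, hy⟩ := hsurj f
  refine ⟨lam, fun h => hv.2 (by rw [← hST v, hTv, h, zero_smul, map_zero]), n, x, y, hx, ?_,
    by rwa [hy]⟩
  have hadj : ∀ x y, B (T x) y = B x (S y) := fun x y => by rw [hT x, hT (S y), hTS]
  set z := ((S - algebraMap F _ lam) ^ (n + 1)) y with hz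
  have hBz : ∀ u, B u z = 0 := fun u => by
    rw [hz, ← adjoint_sub_pow hadj, hy]
    exact LinearMap.mem_ker.1 (hfr ⟨u, rfl⟩)
  have h0 : S z = 0 := hB _ fun u => by rw [hT, hTS, hBz]
  rw [← hTS z, h0, map_zero]

theorem hasCanonicalSummand_of_nondegenerate [IsAlgClosed F] (h2 : (2 : F) ≠ 0)
    [FiniteDimensional F V] [Nontrivial V] (hB : ∀ x, (∀ y, B x y = 0) → x = 0) :
    HasCanonicalSummand B := by
  obtain ⟨⟨T, S, hTS, hST, hT⟩, hsurj⟩ := exists_asymmetry hB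
  obtain ⟨lam, hlam0, n, x, y, hx, hy, hxy⟩ := exists_paired_jordan_chains hB hsurj hTS hST hT
  by_cases hlam : lam = (-1) ^ n
  · have hlam2 : lam * lam = 1 := by rw [hlam, ← mul_pow]; simp
    have hl1 : lam * (-1) ^ n = 1 := by rw [← hlam, hlam2]
    have hy' : ((T - algebraMap F _ lam) ^ (n + 1)) y = 0 := by
      have hfac : T - algebraMap F _ lam = (-lam) • T * (S - algebraMap F _ lam) := by
        ext v
        simp [hTS, smul_sub, smul_smul, hlam2]
      have hcomm : Commute ((-lam) • T) (S - algebraMap F _ lam) := by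
        refine Commute.sub_right (Commute.smul_left ?_ _) (Algebra.commutes lam _).symm
        ext v
        simp [hTS, hST]
      rw [hfac, hcomm.mul_pow, Module.End.mul_apply, hy, map_zero]
    have hfin : ∀ w, ((T - algebraMap F _ lam) ^ (n + 1)) w = 0 →
        B (((T - algebraMap F _ lam) ^ n) w) w ≠ 0 → HasCanonicalSummand B := by
      intro w hw hww
      rw [hlam] at hw hww
      exact hasCanonicalSummand_of_eq_neg_one_pow h2 hT hw hww
    by_contra hcon
    have hxx := not_not.1 fun h => hcon (hfin x hx h)
    have hyy := not_not.1 fun h => hcon (hfin y hy' h)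
    have hsum := not_not.1 fun h => hcon (hfin (x + y) (by rw [map_add, hx, hy', add_zero]) h)
    have hsymm := apply_pow_comm hT (by rw [pow_two, hlam2]) hy' hx
    rw [hl1, one_mul] at hsymm
    simp only [map_add, LinearMap.add_apply, hxx, hyy, hsymm] at hsum
    refine mul_ne_zero h2 hxy ?_
    linear_combination hsum
  · exact hasCanonicalSummand_of_ne_neg_one_pow h2 hT hTS hlam0 hlam hx hy hxy

end Asymmetry

theorem hasCanonicalBasis [IsAlgClosed F] (h2 : (2 : F) ≠ 0) [FiniteDimensional F V]
    (B : V →ₗ[F] V →ₗ[F] F) : HasCanonicalBasis B := by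
  refine hasCanonicalBasis_of_forall_exists_summand (fun W _ _ _ _ B => ?_) V B
  by_cases h : ∃ x ≠ 0, ∀ y, B x y = 0
  · obtain ⟨x, hx, hBx⟩ := h
    obtain ⟨n, e, he⟩ := exists_isNilpotentChain B x hx hBx
    exact he.hasCanonicalSummand
  · push Not at h
    refine hasCanonicalSummand_of_nondegenerate h2 fun x hx => ?_
    by_contra hx0
    obtain ⟨y, hy⟩ := h x hx0
    exact hy (hx y)

end BilinearForm

/-- over an algebraically closed field of characteristic not 2, every
square matrix is congruent to a direct sum of blocks `[J_m(λ) ╲ I_m]` (`λ ≠ (-1)^(m+1)`),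
`Γ_r`, and `J_s(0)` (`s` odd). -/
theorem stmt_14 {F : Type*} [Field F] [IsAlgClosed F] (hchar : (2 : F) ≠ 0) {n : ℕ}
    (M : Matrix (Fin n) (Fin n) F) :
    ∃ (k : ℕ) (d : Fin k → ℕ) (blocks : ∀ i : Fin k, Matrix (Fin (d i)) (Fin (d i)) F),
      (∀ i : Fin k, GoodBlock14 (blocks i)) ∧
      ∃ e : Fin n ≃ (Σ i : Fin k, Fin (d i)),
        MatCongruent M (Matrix.reindex e.symm e.symm (Matrix.blockDiagonal' blocks)) := by
  exact exists_matCongruent_of_hasCanonicalBasis M (hasCanonicalBasis hchar _)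
end

section
/- Let F be an algebraically closed field of characteristic different from 2 and let M be an n×n matrix over F. Then M ∉ Ξ_n(F) if and only if M has a direct summand for congruence of the form Γ_r with r odd or of the form J_s(0) with s odd. -/
open Matrix Polynomial

variable {F : Type*} [Field F]

universe u v

section Reduction

variable {V : Type u} [AddCommGroup V] [Module F V]

theorem exists_mem_apply_eq_of_vanish [FiniteDimensional F V] (B : V →ₗ[F] V →ₗ[F] F)
    (R : Submodule F V) (f : V →ₗ[F] F) (h : ∀ v, (∀ r ∈ R, B r v = 0) → f v = 0) :
    ∃ r ∈ R, B r = f := by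
  have key := Subspace.dualCoannihilator_dualAnnihilator_eq (K := F) (V := V)
    (W := (R.map B : Submodule F (Module.Dual F V)))
  have hf : f ∈ (R.map B : Submodule F (Module.Dual F V)) := by
    rw [← key, Submodule.mem_dualAnnihilator]
    intro v hv
    rw [Submodule.mem_dualCoannihilator] at hv
    exact h v fun r hr => hv _ (Submodule.mem_map_of_mem hr)
  exact Submodule.mem_map.1 hf

/-- `σ` identifies `W` with a complement of `R` in the orthogonal space of `R`. -/
structure IsReduction {W : Type v} [AddCommGroup W] [Module F W] (B : V →ₗ[F] V →ₗ[F] F)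
    (R : Submodule F V) (σ : W →ₗ[F] V) : Prop where
  perp : ∀ w, ∀ r ∈ R, B r (σ w) = 0
  split : ∀ v, (∀ r ∈ R, B r v = 0) → ∃ w, v - σ w ∈ R
  inj : ∀ w, σ w ∈ R → w = 0

theorem det_mul_det_eq_one_of_pairing {X Y : Type*} [AddCommGroup X] [Module F X]
    [FiniteDimensional F X] [AddCommGroup Y] [Module F Y] (e : Y ≃ₗ[F] Module.Dual F X)
    (S : X →ₗ[F] X) (T : Y →ₗ[F] Y) (h : ∀ x y, e (T y) (S x) = e y x) :
    LinearMap.det S * LinearMap.det T = 1 := by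
  rw [← LinearMap.det_dualMap S, ← LinearMap.det_conj T e, ← LinearMap.det_comp]
  convert LinearMap.det_id
  ext φ x
  simpa using h x (e.symm φ)

theorem exists_isReduction [FiniteDimensional F V] (B : V →ₗ[F] V →ₗ[F] F)
    (R : Submodule F V) (hR : ∀ r ∈ R, ∀ s ∈ R, B r s = 0)
    (hinj : ∀ r ∈ R, B r = 0 → r = 0) (T : V →ₗ[F] V)
    (hT : ∀ v w, B (T v) (T w) = B v w) (hTR : ∀ r ∈ R, T r ∈ R)
    (hdet : LinearMap.det T ≠ 0) :
    ∃ (W : Type u) (_ : AddCommGroup W) (_ : Module F W) (_ : FiniteDimensional F W)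
      (σ : W →ₗ[F] V) (T' : W →ₗ[F] W), IsReduction B R σ ∧
      (∀ w, T (σ w) - σ (T' w) ∈ R) ∧ LinearMap.det T = LinearMap.det T' ∧
      Module.finrank F W + Module.finrank F R ≤ Module.finrank F V := by
  let P : Submodule F V := (R.map B : Submodule F (Module.Dual F V)).dualCoannihilator
  have hP : ∀ v, v ∈ P ↔ ∀ r ∈ R, B r v = 0 := by
    intro v
    simp [P, Submodule.mem_dualCoannihilator]
  have hRP : R ≤ P := fun s hs => (hP s).2 fun r hr => hR r hr s hs
  have hTinj : Function.Injective T :=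
    ((LinearMap.isUnit_iff_isUnit_det T).2 hdet.isUnit |> (Module.End.isUnit_iff T).1).1
  have hTRr : R ≤ R.comap T := hTR
  have hsurj : ∀ r ∈ R, ∃ s ∈ R, T s = r := by
    intro r hr
    have h1 : Function.Injective (T.restrict hTR) := by
      intro a b hab
      apply Subtype.ext
      apply hTinj
      simpa using congrArg Subtype.val hab
    obtain ⟨s, hs⟩ := LinearMap.surjective_of_injective h1 ⟨r, hr⟩
    exact ⟨s, s.2, by simpa using congrArg Subtype.val hs⟩
  have hTP : P ≤ P.comap T := by
    intro v hv
    rw [Submodule.mem_comap, hP]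
    intro r hr
    obtain ⟨s, hs, rfl⟩ := hsurj r hr
    rw [hT]
    exact (hP v).1 hv s hs
  let R' : Submodule F P := R.comap P.subtype
  have hTR' : R' ≤ R'.comap (T.restrict hTP) := by
    intro v hv
    exact hTR _ hv
  have det1 := LinearMap.det_eq_det_mul_det P T hTP
  have det2 := LinearMap.det_eq_det_mul_det R' (T.restrict hTP) hTR'
  let ψ : V →ₗ[F] Module.Dual F R := (B.domRestrict R).flip
  have hker : LinearMap.ker ψ = P := by
    ext v
    rw [LinearMap.mem_ker, hP]
    exact ⟨fun h r hr => LinearMap.congr_fun h ⟨r, hr⟩, fun h => LinearMap.ext fun r => h r r.2⟩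
  have hrange : LinearMap.range ψ = ⊤ := by
    rw [← Subspace.dualCoannihilator_dualAnnihilator_eq (W := LinearMap.range ψ),
      LinearMap.dualCoannihilator_range_eq_ker_flip, LinearMap.ker_eq_bot'.2,
      Submodule.dualAnnihilator_bot]
    intro r hr
    exact Subtype.ext (hinj r r.2 (LinearMap.ext fun v => LinearMap.congr_fun hr v))
  let e : (V ⧸ P) ≃ₗ[F] Module.Dual F R :=
    (Submodule.quotEquivOfEq P _ hker.symm).trans
      (ψ.quotKerEquivOfSurjective (LinearMap.range_eq_top.1 hrange))
  have det3 := det_mul_det_eq_one_of_pairing e (T.restrict hTRr) (P.mapQ P T hTP) (by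
    intro r v
    obtain ⟨v, rfl⟩ := P.mkQ_surjective v
    exact hT r v)
  have det4 : LinearMap.det ((T.restrict hTP).restrict hTR') = LinearMap.det (T.restrict hTRr) := by
    rw [← LinearMap.det_conj _ (Submodule.comapSubtypeEquivOfLe hRP)]
    rfl
  obtain ⟨s, hs⟩ := R'.mkQ.exists_rightInverse_of_surjective R'.range_mkQ
  have hmem : ∀ z, R'.mkQ z = 0 → z ∈ R' := fun z => (Submodule.Quotient.mk_eq_zero R').1
  have hs' : ∀ w, R'.mkQ (s w) = w := LinearMap.congr_fun hs
  refine ⟨P ⧸ R', inferInstance, inferInstance, inferInstance, P.subtype ∘ₗ s,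
    R'.mapQ R' (T.restrict hTP) hTR', ⟨?_, ?_, ?_⟩, ?_, ?_, ?_⟩
  · intro w r hr
    exact (hP _).1 (s w).2 r hr
  · intro v hv
    refine ⟨R'.mkQ ⟨v, (hP v).2 hv⟩, ?_⟩
    have : (⟨v, (hP v).2 hv⟩ : P) - s (R'.mkQ ⟨v, (hP v).2 hv⟩) ∈ R' :=
      hmem _ (by rw [map_sub, hs', sub_self])
    exact this
  · intro w hw
    rw [← hs' w]
    exact (Submodule.Quotient.mk_eq_zero R').2 hw
  · intro w
    have : (T.restrict hTP) (s w) - s (R'.mapQ R' (T.restrict hTP) hTR' w) ∈ R' := by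
      apply hmem
      rw [map_sub, hs', sub_eq_zero]
      conv_rhs => rw [← hs' w]
      rfl
    exact this
  · rw [det1, det2, det4, mul_right_comm, det3, one_mul]
  · have h1 := Submodule.finrank_quotient_add_finrank R'
    have h2 := (Submodule.comapSubtypeEquivOfLe hRP).finrank_eq
    have h3 := Submodule.finrank_le P
    change Module.finrank F R' = _ at h2
    omega

end Reduction

section Isometry

variable {V : Type u} [AddCommGroup V] [Module F V]

theorem IsReduction.exists_eq [FiniteDimensional F V] {W : Type v} [AddCommGroup W] [Module F W]
    {B : V →ₗ[F] V →ₗ[F] F} {R : Submodule F V} {σ : W →ₗ[F] V} (h : IsReduction B R σ)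
    (f : V →ₗ[F] F) (hfR : ∀ r ∈ R, f r = 0) (hfσ : ∀ w, f (σ w) = 0) : ∃ r ∈ R, B r = f := by
  refine exists_mem_apply_eq_of_vanish B R f fun v hv => ?_
  obtain ⟨w, hw⟩ := h.split v hv
  have := hfR _ hw
  rwa [map_sub, hfσ, sub_zero] at this

theorem apply_map_apply_map_of_sub_mem {W : Type v} [AddCommGroup W] [Module F W]
    {R : Submodule F V} {σ : W →ₗ[F] V} {T : V →ₗ[F] V} {T' : W →ₗ[F] W}
    (hσ : ∀ w, T (σ w) - σ (T' w) ∈ R) (C : V →ₗ[F] V →ₗ[F] F)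
    (hT : ∀ v w, C (T v) (T w) = C v w) (hl : ∀ r ∈ R, ∀ w, C r (σ w) = 0)
    (hr : ∀ r ∈ R, ∀ w, C (σ w) r = 0) (hR : ∀ r ∈ R, ∀ s ∈ R, C r s = 0) (v w : W) :
    C (σ (T' v)) (σ (T' w)) = C (σ v) (σ w) := by
  rw [← hT (σ v), ← sub_add_cancel (T (σ v)) (σ (T' v)), ← sub_add_cancel (T (σ w)) (σ (T' w))]
  simp only [map_add, LinearMap.add_apply, hl _ (hσ v), hr _ (hσ w), hR _ (hσ v) _ (hσ w),
    zero_add]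

theorem apply_eq_neg_apply_of_alternating {A : V →ₗ[F] V →ₗ[F] F} (hA : ∀ v, A v v = 0) (v w : V) :
    A v w = -A w v := by
  have h := hA (v + w)
  simp only [map_add, LinearMap.add_apply, hA, zero_add, add_zero] at h
  exact eq_neg_of_add_eq_zero_right h

/-- Isometries of a nondegenerate alternating form are unimodular. -/
theorem det_eq_one_of_alternating [IsAlgClosed F] (N : ℕ) :
    ∀ (V : Type u) [AddCommGroup V] [Module F V] [FiniteDimensional F V]
      (A : V →ₗ[F] V →ₗ[F] F) (T : V →ₗ[F] V), Module.finrank F V ≤ N → (∀ v, A v v = 0) →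
      (∀ v, A v = 0 → v = 0) → (∀ v w, A (T v) (T w) = A v w) → LinearMap.det T ≠ 0 →
      LinearMap.det T = 1 := by
  induction N with
  | zero =>
    intro V _ _ _ A T hN _ _ _ _
    have : Subsingleton V := Module.finrank_zero_iff.1 (Nat.le_zero.1 hN)
    exact LinearMap.det_eq_one_of_subsingleton T
  | succ N ih =>
    intro V _ _ _ A T hN hA hnd hT hdet
    rcases subsingleton_or_nontrivial V with hV | hV
    · exact LinearMap.det_eq_one_of_subsingleton T
    obtain ⟨c, hc⟩ := Module.End.exists_eigenvalue T
    obtain ⟨x, hx⟩ := hc.exists_hasEigenvector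
    have hAs := apply_eq_neg_apply_of_alternating hA
    have hR : ∀ r ∈ F ∙ x, ∀ s ∈ F ∙ x, A r s = 0 := by
      intro r hr s hs
      obtain ⟨a, rfl⟩ := Submodule.mem_span_singleton.1 hr
      obtain ⟨b, rfl⟩ := Submodule.mem_span_singleton.1 hs
      simp [hA]
    obtain ⟨W, _, _, _, σ, T', hσ, hT', hdetT, hfin⟩ := exists_isReduction A (F ∙ x) hR
      (fun r _ hr => hnd r hr) T hT (by
        intro r hr
        obtain ⟨a, rfl⟩ := Submodule.mem_span_singleton.1 hr
        rw [map_smul, hx.apply_eq_smul]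
        exact Submodule.smul_mem _ _ (Submodule.smul_mem _ _ (Submodule.mem_span_singleton_self x)))
      hdet
    rw [finrank_span_singleton hx.2] at hfin
    have hl : ∀ r ∈ F ∙ x, ∀ w, A r (σ w) = 0 := fun r hr w => hσ.perp w r hr
    have hr : ∀ r ∈ F ∙ x, ∀ w, A (σ w) r = 0 := fun r hr w => by rw [hAs, hl r hr, neg_zero]
    rw [hdetT] at hdet ⊢
    refine ih W (A.compl₁₂ σ σ) T' (by omega) (fun v => hA _) ?_
      (apply_map_apply_map_of_sub_mem hT' A hT hl hr hR) hdet
    intro w hw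
    obtain ⟨r, hrR, hrw⟩ := hσ.exists_eq (A (σ w)) (fun r h => hr r h w)
      (fun w' => LinearMap.congr_fun hw w')
    apply hσ.inj
    have := hnd (r - σ w) (by rw [map_sub, hrw, sub_self])
    rwa [← sub_eq_zero.1 this]

end Isometry

section OddChain

variable {V : Type u} [AddCommGroup V] [Module F V]

/-- A Kronecker chain `x 0, …, x k` of the pair of an alternating form `A` and a symmetric form `B`,
together with dual vectors `y 0, …, y (k - 1)`; these `2 * k + 1` vectors span a common orthogonal
summand, which is singular for `B` exactly when `γ = 0`. -/
structure OddChain (A B : V →ₗ[F] V →ₗ[F] F) (γ : F) (k : ℕ) (x y : ℕ → V) : Prop where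
  ne_zero : x 0 ≠ 0
  A_zero : A (x 0) = 0
  A_succ : ∀ i < k, A (x (i + 1)) = B (x i)
  B_last : γ = 0 → B (x k) = 0
  B_last_eq : ∀ j, j + 1 = k → B (x k) = -γ • A (y j)
  B_succ : ∀ j, j + 1 < k → B (y (j + 1)) = -A (y j)
  B_x_x : ∀ i ≤ k, ∀ j ≤ k, B (x i) (x j) = if i = k ∧ j = k then γ else 0
  B_x_y : ∀ i ≤ k, ∀ j < k, B (x i) (y j) = if i = j then 1 else 0
  B_y_y : ∀ i < k, ∀ j < k, B (y i) (y j) = 0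

/-- The sequence `a, f 0, f 1, …`. -/
def seqCons (a : V) (f : ℕ → V) : ℕ → V
  | 0 => a
  | i + 1 => f i

theorem OddChain.lift [FiniteDimensional F V] (hchar : (2 : F) ≠ 0) {W : Type v} [AddCommGroup W]
    [Module F W] {A B : V →ₗ[F] V →ₗ[F] F} (hA : ∀ v, A v v = 0) (hB : ∀ v w, B v w = B w v)
    {σ : W →ₗ[F] V} (hσ : IsReduction B (LinearMap.ker A) σ)
    (hR : ∀ r, A r = 0 → ∀ s, A s = 0 → B r s = 0) {γ : F} {k : ℕ} {x y : ℕ → W}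
    (h : OddChain (A.compl₁₂ σ σ) (B.compl₁₂ σ σ) γ k x y) :
    ∃ x' y' : ℕ → V, OddChain A B γ (k + 1) x' y' := by
  have hAs := apply_eq_neg_apply_of_alternating hA
  have hAr : ∀ r, A r = 0 → ∀ v, A v r = 0 := fun r hr v => by
    rw [hAs, hr, LinearMap.zero_apply, neg_zero]
  have hperp : ∀ w r, A r = 0 → B r (σ w) = 0 := hσ.perp
  have hperp' : ∀ w r, A r = 0 → B (σ w) r = 0 := fun w r hr => by rw [hB, hperp w r hr]
  have hcomp : ∀ (C : V →ₗ[F] V →ₗ[F] F) v w, C (σ v) (σ w) = C.compl₁₂ σ σ v w :=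
    fun _ _ _ => rfl
  have hex : ∀ f : V →ₗ[F] F, (∀ r, A r = 0 → f r = 0) → (∀ w, f (σ w) = 0) →
      ∃ r, A r = 0 ∧ B r = f := hσ.exists_eq
  have hsolve : ∀ f : V →ₗ[F] F, (∀ r, A r = 0 → f r = 0) → ∃ v, A v = f := by
    intro f hf
    obtain ⟨v, -, hv⟩ := exists_mem_apply_eq_of_vanish A ⊤ f fun v hv =>
      hf v (LinearMap.ext fun w => by rw [hAs, hv w trivial, neg_zero, LinearMap.zero_apply])
    exact ⟨v, hv⟩
  have hfix : ∀ (f : V →ₗ[F] F) (a : W), (∀ r, A r = 0 → f r = 0) →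
      (∀ w, f (σ w) = B (σ a) (σ w)) → ∃ r, A r = 0 ∧ f = B (σ a + r) := by
    intro f a h1 h2
    obtain ⟨r, hr, hf⟩ := hex (f - B (σ a))
      (fun r hr => by rw [LinearMap.sub_apply, h1 r hr, hperp' a r hr, sub_zero])
      fun w => by rw [LinearMap.sub_apply, h2, sub_self]
    exact ⟨r, hr, by rw [map_add, hf, add_sub_cancel]⟩
  have hρ : ∀ i, ∃ r, A r = 0 ∧ (i < k → A (σ (x (i + 1))) = B (σ (x i) + r)) ∧
      (i = k → (γ = 0 → B (σ (x k) + r) = 0) ∧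
        ∀ j, j + 1 = k → B (σ (x k) + r) = -γ • A (σ (y j))) := by
    intro i
    rcases lt_trichotomy i k with hi | rfl | hi
    · obtain ⟨r, hr, hf⟩ := hfix (A (σ (x (i + 1)))) (x i) (fun r hr => hAr r hr _) fun w => by
        rw [hcomp, hcomp, h.A_succ i hi]
      exact ⟨r, hr, fun _ => hf, fun h => absurd h hi.ne⟩
    · by_cases hγ : γ = 0
      · obtain ⟨r, hr, hf⟩ := hfix 0 (x i) (fun _ _ => rfl) fun w => by
          rw [hcomp, h.B_last hγ]; rfl
        exact ⟨r, hr, fun h => absurd h (lt_irrefl i), fun _ =>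
          ⟨fun _ => hf.symm, fun j _ => by rw [← hf, hγ, neg_zero, zero_smul]⟩⟩
      · rcases i with _ | i
        · exact ⟨0, map_zero A, fun h => absurd h (lt_irrefl 0), fun _ =>
            ⟨fun h => absurd h hγ, fun j hj => by omega⟩⟩
        · obtain ⟨r, hr, hf⟩ := hfix (-γ • A (σ (y i))) (x (i + 1))
            (fun r hr => by rw [LinearMap.smul_apply, hAr r hr, smul_zero]) fun w => by
              rw [hcomp, h.B_last_eq i rfl]; rfl
          refine ⟨r, hr, fun h => absurd h (lt_irrefl _), fun _ =>
            ⟨fun h => absurd h hγ, fun j hj => ?_⟩⟩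
          obtain rfl : j = i := by omega
          exact hf.symm
    · exact ⟨0, map_zero A, fun h => by omega, fun h => by omega⟩
  have hτ : ∀ j, ∃ r, A r = 0 ∧ ∀ i, i + 1 = j → j < k → B (σ (y j) + r) = -A (σ (y i)) := by
    intro j
    rcases j with _ | j
    · exact ⟨0, map_zero A, fun i hi => by omega⟩
    by_cases hj : j + 1 < k
    · obtain ⟨r, hr, hf⟩ := hfix (-A (σ (y j))) (y (j + 1))
        (fun r hr => by rw [LinearMap.neg_apply, hAr r hr, neg_zero]) fun w => by
          rw [hcomp, h.B_succ j hj]; rfl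
      refine ⟨r, hr, fun i hi _ => ?_⟩
      obtain rfl : i = j := by omega
      exact hf.symm
    · exact ⟨0, map_zero A, fun i _ h => absurd h hj⟩
  choose ρ hρA hρ1 hρ2 using hρ
  choose τ hτA hτ1 using hτ
  have hρ3 : γ = 0 → B (σ (x k) + ρ k) = 0 := (hρ2 k rfl).1
  have hρ4 := (hρ2 k rfl).2
  obtain ⟨X, hX⟩ : ∃ X : ℕ → V, ∀ i, X i = σ (x i) + ρ i := ⟨_, fun _ => rfl⟩
  obtain ⟨Y, hY⟩ : ∃ Y : ℕ → V, ∀ i, Y i = σ (y i) + τ i := ⟨_, fun _ => rfl⟩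
  have hAX : ∀ i, A (X i) = A (σ (x i)) := fun i => by rw [hX, map_add, hρA, add_zero]
  have hAY : ∀ i, A (Y i) = A (σ (y i)) := fun i => by rw [hY, map_add, hτA, add_zero]
  have hred : ∀ v w r s, A r = 0 → A s = 0 → B (σ v + r) (σ w + s) = B.compl₁₂ σ σ v w := by
    intro v w r s hr hs
    simp only [map_add, LinearMap.add_apply, hperp _ r hr, hperp' _ s hs, hR r hr s hs, add_zero,
      hcomp]
  have hXsucc : ∀ i < k, A (X (i + 1)) = B (X i) := fun i hi => by rw [hAX, hρ1 i hi, hX]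
  have hXlast : γ = 0 → B (X k) = 0 := fun hγ => by rw [hX, hρ3 hγ]
  have hXlast' : ∀ j, j + 1 = k → B (X k) = -γ • A (Y j) := fun j hj => by
    rw [hX, hρ4 j hj, hAY]
  have hYsucc : ∀ j, j + 1 < k → B (Y (j + 1)) = -A (Y j) := fun j hj => by
    rw [hY, hτ1 (j + 1) j rfl hj, hAY]
  have hXX : ∀ i ≤ k, ∀ j ≤ k, B (X i) (X j) = if i = k ∧ j = k then γ else 0 :=
    fun i hi j hj => by rw [hX, hX, hred _ _ _ _ (hρA i) (hρA j), h.B_x_x i hi j hj]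
  have hXY : ∀ i ≤ k, ∀ j < k, B (X i) (Y j) = if i = j then 1 else 0 :=
    fun i hi j hj => by rw [hX, hY, hred _ _ _ _ (hρA i) (hτA j), h.B_x_y i hi j hj]
  have hYY : ∀ i < k, ∀ j < k, B (Y i) (Y j) = 0 :=
    fun i hi j hj => by rw [hY, hY, hred _ _ _ _ (hτA i) (hτA j), h.B_y_y i hi j hj]
  have hRX : ∀ r, A r = 0 → ∀ i, B r (X i) = 0 := fun r hr i => by
    rw [hX, map_add, hperp _ r hr, hR r hr _ (hρA i), add_zero]
  have hRY : ∀ r, A r = 0 → ∀ i, B r (Y i) = 0 := fun r hr i => by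
    rw [hY, map_add, hperp _ r hr, hR r hr _ (hτA i), add_zero]
  obtain ⟨r₀, hr₀, hBr₀⟩ := hex (A (X 0)) (fun r hr => hAr r hr _) fun w => by
    rw [hAX, hcomp, h.A_zero, LinearMap.zero_apply]
  have hBr₀' : ∀ v, B r₀ v = -A v (X 0) := fun v => by rw [hBr₀, hAs]
  have hr₀' : r₀ ≠ 0 := by
    rintro rfl
    rw [map_zero, hAX] at hBr₀
    exact h.ne_zero (hσ.inj _ hBr₀.symm)
  have hy : ∃ y₀, B r₀ y₀ = 1 ∧ (0 < k → A y₀ = -B (Y 0)) ∧ (k = 0 → B (X 0) = -γ • A y₀) := by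
    rcases Nat.eq_zero_or_pos k with rfl | hk
    · by_cases hγ : γ = 0
      · obtain ⟨v, hv⟩ : ∃ v, B r₀ v ≠ 0 := by
          by_contra! hv
          refine h.ne_zero (hσ.inj _ ?_)
          rw [LinearMap.mem_ker, ← hAX, ← hBr₀]
          exact LinearMap.ext hv
        refine ⟨(B r₀ v)⁻¹ • v, by simp [hv], fun h => absurd h (lt_irrefl 0), fun _ => ?_⟩
        rw [hXlast hγ, hγ, neg_zero, zero_smul]
      · obtain ⟨y₀, hy₀⟩ := hsolve (-γ⁻¹ • B (X 0)) fun r hr => by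
          rw [LinearMap.smul_apply, hB, hRX r hr, smul_zero]
        refine ⟨y₀, ?_, fun h => absurd h (lt_irrefl 0), fun _ => ?_⟩
        · rw [hBr₀', hy₀, LinearMap.smul_apply, hXX 0 le_rfl 0 le_rfl]
          simp [hγ]
        · rw [hy₀, smul_smul, neg_mul_neg, mul_inv_cancel₀ hγ, one_smul]
    · obtain ⟨y₀, hy₀⟩ := hsolve (-B (Y 0)) fun r hr => by
        rw [LinearMap.neg_apply, hB, hRY r hr, neg_zero]
      refine ⟨y₀, ?_, fun _ => hy₀, fun h => by omega⟩
      rw [hBr₀', hy₀, LinearMap.neg_apply, neg_neg, hB, hXY 0 hk.le 0 hk, if_pos rfl]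
  obtain ⟨y₀, hy₁, hy₂, hy₃, hyy⟩ : ∃ y₀, B r₀ y₀ = 1 ∧ (0 < k → A y₀ = -B (Y 0)) ∧
      (k = 0 → B (X 0) = -γ • A y₀) ∧ B y₀ y₀ = 0 := by
    obtain ⟨y₀, h1, h2, h3⟩ := hy
    refine ⟨y₀ - (B y₀ y₀ / 2) • r₀, ?_, ?_, ?_, ?_⟩
    · simp [h1, hR r₀ hr₀ r₀ hr₀]
    · intro hk
      simp [hr₀, h2 hk]
    · intro hk
      simp [hr₀, h3 hk]
    · simp only [map_sub, map_smul, LinearMap.sub_apply, LinearMap.smul_apply, hB y₀ r₀, h1,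
        hR r₀ hr₀ r₀ hr₀, smul_eq_mul]
      field_simp
      ring
  have hAy : 0 < k → ∀ v, A v y₀ = B (Y 0) v := fun hk v => by
    rw [hAs, hy₂ hk, LinearMap.neg_apply, neg_neg]
  have hXy : ∀ i ≤ k, B (X i) y₀ = 0 := by
    intro i hi
    rcases hi.lt_or_eq with hi | rfl
    · rw [← hXsucc i hi, hAy (by omega), hB, hXY _ hi 0 (by omega), if_neg (by omega)]
    · rcases i with _ | i
      · rw [hy₃ rfl, LinearMap.smul_apply, hA, smul_zero]
      · rw [hXlast' i rfl, LinearMap.smul_apply, hAy (by omega), hYY _ (by omega) _ (by omega),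
          smul_zero]
  have hYy : ∀ j < k, B (Y j) y₀ = 0 := by
    rintro (_ | j) hj
    · rw [← hAy hj, hA]
    · rw [hYsucc j hj, LinearMap.neg_apply, hAy (by omega), hYY _ (by omega) _ (by omega), neg_zero]
  refine ⟨seqCons r₀ X, seqCons y₀ Y, hr₀', hr₀, ?_, hXlast, ?_, ?_, ?_, ?_, ?_⟩
  · rintro (_ | i) hi
    · exact hBr₀.symm
    · exact hXsucc i (by omega)
  · rintro (_ | j) hj
    · obtain rfl : k = 0 := by omega
      exact hy₃ rfl
    · exact hXlast' j (by omega)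
  · rintro (_ | j) hj
    · change B (Y 0) = -A y₀
      rw [hy₂ (by omega), neg_neg]
    · exact hYsucc j (by omega)
  · rintro (_ | i) hi (_ | j) hj
    · simpa [seqCons] using hR r₀ hr₀ r₀ hr₀
    · simpa [seqCons] using hRX r₀ hr₀ j
    · simpa [seqCons, hB _ r₀] using hRX r₀ hr₀ i
    · simpa [seqCons] using hXX i (by omega) j (by omega)
  · rintro (_ | i) hi (_ | j) hj
    · simpa [seqCons] using hy₁
    · simpa [seqCons] using hRY r₀ hr₀ j
    · simpa [seqCons] using hXy i (by omega)
    · simpa [seqCons] using hXY i (by omega) j (by omega)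
  · rintro (_ | i) hi (_ | j) hj
    · exact hyy
    · change B y₀ (Y j) = 0
      rw [hB, hYy j (by omega)]
    · exact hYy i (by omega)
    · exact hYY i (by omega) j (by omega)

theorem oddChain_zero {A B : V →ₗ[F] V →ₗ[F] F} {r : V} (hr : r ≠ 0) (hA : A r = 0)
    (h : B r r = 0 → B r = 0) : OddChain A B (B r r) 0 (fun _ => r) fun _ => 0 where
  ne_zero := hr
  A_zero := hA
  A_succ i hi := by omega
  B_last := h
  B_last_eq j hj := by omega
  B_succ j hj := by omega
  B_x_x i hi j hj := by rw [if_pos (by omega)]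
  B_x_y i hi j hj := by omega
  B_y_y i hi j hj := by omega

/-- An isometry that is not unimodular forces an odd chain. -/
theorem exists_oddChain [IsAlgClosed F] (hchar : (2 : F) ≠ 0) (N : ℕ) :
    ∀ (V : Type u) [AddCommGroup V] [Module F V] [FiniteDimensional F V]
      (A B : V →ₗ[F] V →ₗ[F] F) (T : V →ₗ[F] V), Module.finrank F V ≤ N → (∀ v, A v v = 0) →
      (∀ v w, B v w = B w v) → (∀ v w, A (T v) (T w) = A v w) →
      (∀ v w, B (T v) (T w) = B v w) → LinearMap.det T ≠ 0 → LinearMap.det T ≠ 1 →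
      ∃ γ k x y, OddChain A B γ k x y := by
  induction N with
  | zero =>
    intro V _ _ _ A B T hN _ _ _ _ _ hdet
    have : Subsingleton V := Module.finrank_zero_iff.1 (Nat.le_zero.1 hN)
    exact absurd (LinearMap.det_eq_one_of_subsingleton T) hdet
  | succ N ih =>
    intro V _ _ _ A B T hN hA hB hTA hTB hdet hdet1
    by_cases hnd : ∀ v, A v = 0 → v = 0
    · exact absurd (det_eq_one_of_alternating _ V A T le_rfl hA hnd hTA hdet) hdet1
    by_cases hiso : ∀ r, A r = 0 → B r r = 0
    swap
    · push Not at hiso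
      obtain ⟨r, hr, hrr⟩ := hiso
      exact ⟨_, _, _, _, oddChain_zero (fun h => hrr (by simp [h])) hr fun h => absurd h hrr⟩
    by_cases hinj : ∀ r, A r = 0 → B r = 0 → r = 0
    swap
    · push Not at hinj
      obtain ⟨r, hr, hBr, hr0⟩ := hinj
      exact ⟨_, _, _, _, oddChain_zero hr0 hr fun _ => hBr⟩
    have hAs := apply_eq_neg_apply_of_alternating hA
    have hR : ∀ r, A r = 0 → ∀ s, A s = 0 → B r s = 0 := by
      intro r hr s hs
      have h := hiso (r + s) (by rw [map_add, hr, hs, add_zero])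
      simp only [map_add, LinearMap.add_apply, hiso r hr, hiso s hs, hB s r, zero_add,
        add_zero, ← two_mul] at h
      exact (mul_eq_zero.1 h).resolve_left hchar
    have hsurj : Function.Surjective T :=
      ((Module.End.isUnit_iff T).1 ((LinearMap.isUnit_iff_isUnit_det T).2 hdet.isUnit)).2
    obtain ⟨W, _, _, _, σ, T', hσ, hT', hdetT, hfin⟩ := exists_isReduction B (LinearMap.ker A) hR
      hinj T hTB (by
        intro r (hr : A r = 0)
        refine LinearMap.ext fun v => ?_
        obtain ⟨w, rfl⟩ := hsurj v
        rw [hTA, hr]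
        rfl) hdet
    have hpos : 0 < Module.finrank F (LinearMap.ker A) := by
      push Not at hnd
      obtain ⟨v, hv, hv0⟩ := hnd
      have : Nontrivial (LinearMap.ker A) := ⟨⟨⟨v, hv⟩, 0, fun h => hv0 (congrArg Subtype.val h)⟩⟩
      exact Module.finrank_pos
    have hAr : ∀ r ∈ LinearMap.ker A, ∀ v, A r v = 0 := fun r hr v => LinearMap.congr_fun hr v
    have hAr' : ∀ r ∈ LinearMap.ker A, ∀ v, A v r = 0 := fun r hr v => by
      rw [hAs, hAr r hr, neg_zero]
    obtain ⟨γ, k, x, y, h⟩ := ih W (A.compl₁₂ σ σ) (B.compl₁₂ σ σ) T' (by omega)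
      (fun v => hA _) (fun v w => hB _ _)
      (apply_map_apply_map_of_sub_mem hT' A hTA (fun r hr w => hAr r hr _)
        (fun r hr w => hAr' r hr _) (fun r hr s _ => hAr r hr s))
      (apply_map_apply_map_of_sub_mem hT' B hTB (fun r hr w => hσ.perp w r hr)
        (fun r hr w => by rw [hB]; exact hσ.perp w r hr) (fun r hr s hs => hR r hr s hs))
      (hdetT ▸ hdet) (hdetT ▸ hdet1)
    obtain ⟨x', y', h'⟩ := h.lift hchar hA hB hσ hR
    exact ⟨γ, k + 1, x', y', h'⟩

theorem OddChain.exists_normalized [IsAlgClosed F] {A B : V →ₗ[F] V →ₗ[F] F} {γ : F} {k : ℕ}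
    {x y : ℕ → V} (h : OddChain A B γ k x y) (hγ : γ ≠ 0) :
    ∃ x' y' : ℕ → V, OddChain A B 1 k x' y' := by
  obtain ⟨a, ha⟩ := IsAlgClosed.exists_pow_nat_eq γ⁻¹ (n := 2) (by norm_num)
  have ha0 : a ≠ 0 := by
    rintro rfl
    simp at ha
    exact hγ ha.symm
  have haγ : a * a * γ = 1 := by rw [← sq, ha, inv_mul_cancel₀ hγ]
  refine ⟨fun i => a • x i, fun i => a⁻¹ • y i, ⟨?_, ?_, ?_, ?_, ?_, ?_, ?_, ?_, ?_⟩⟩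
  · simp [ha0, h.ne_zero]
  · simp [h.A_zero]
  · intro i hi
    simp [h.A_succ i hi]
  · simp
  · intro j hj
    simp only [map_smul, h.B_last_eq j hj, smul_smul]
    congr 1
    field_simp
    linear_combination -haγ
  · intro j hj
    simp [h.B_succ j hj]
  · intro i hi j hj
    simp only [map_smul, LinearMap.smul_apply, h.B_x_x i hi j hj, smul_eq_mul]
    split_ifs
    · rw [← mul_assoc, haγ]
    · simp
  · intro i hi j hj
    simp [h.B_x_y i hi j hj, ha0]
  · intro i hi j hj
    simp [h.B_y_y i hi j hj]

/-- The vectors of an odd chain as a finite family. -/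
def chainVec (k : ℕ) (x y : ℕ → V) : Fin (k + 1) ⊕ Fin k → V :=
  Sum.elim (fun i => x i) fun j => y j

theorem OddChain.exists_dual {A B : V →ₗ[F] V →ₗ[F] F}
    (hA : ∀ v, A v v = 0) (hB : ∀ v w, B v w = B w v) {γ : F} {k : ℕ} {x y : ℕ → V}
    (h : OddChain A B γ k x y) :
    ∃ φ : Fin (k + 1) ⊕ Fin k → V →ₗ[F] F,
      (∀ i j, φ i (chainVec k x y j) = if i = j then 1 else 0) ∧
      ∀ v, (∀ i, φ i v = 0) → ∀ i, A (chainVec k x y i) v = 0 ∧ B (chainVec k x y i) v = 0 := by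
  have hAs := apply_eq_neg_apply_of_alternating hA
  obtain ⟨ψ, hψx, hψy, hψ⟩ : ∃ ψ : V →ₗ[F] F, (∀ i ≤ k, ψ (x i) = if i = k then 1 else 0) ∧
      (∀ j < k, ψ (y j) = 0) ∧
      ∀ v, ψ v = 0 → B (x k) v = 0 ∧ ∀ j, j + 1 = k → A (y j) v = 0 := by
    rcases k with _ | k
    · by_cases hγ : γ = 0
      · obtain ⟨f, hf⟩ : ∃ f : V →ₗ[F] F, f (x 0) ≠ 0 := by
          by_contra! hf
          exact h.ne_zero ((Module.forall_dual_apply_eq_zero_iff F _).1 hf)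
        refine ⟨(f (x 0))⁻¹ • f, fun i hi => ?_, fun j hj => by omega, fun v _ => ?_⟩
        · obtain rfl : i = 0 := by omega
          simp [hf]
        · simp [h.B_last hγ]
      · refine ⟨γ⁻¹ • B (x 0), fun i hi => ?_, fun j hj => by omega, fun v hv => ?_⟩
        · obtain rfl : i = 0 := by omega
          simp [h.B_x_x, hγ]
        · simpa [hγ] using hv
    · refine ⟨-A (y k), fun i hi => ?_, fun j hj => ?_, fun v hv => ?_⟩
      · rw [LinearMap.neg_apply, ← hAs]
        rcases i with _ | i
        · simp [h.A_zero]
        · rw [h.A_succ i (by omega), h.B_x_y _ (by omega) _ (by omega)]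
          simp
      · rcases (Nat.lt_succ_iff.1 hj).lt_or_eq with hj' | rfl
        · rw [LinearMap.neg_apply, ← hAs, ← neg_eq_zero, ← LinearMap.neg_apply,
            ← h.B_succ j (by omega), h.B_y_y _ (by omega) _ (by omega)]
        · simp [hA]
      · have hv' : A (y k) v = 0 := neg_eq_zero.1 hv
        refine ⟨by rw [h.B_last_eq k rfl, LinearMap.smul_apply, hv', smul_zero], fun j hj => ?_⟩
        obtain rfl : j = k := by omega
        exact hv'
  refine ⟨Sum.elim (fun i => if (i : ℕ) < k then B (y i) else ψ) fun j => B (x j), ?_, ?_⟩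
  · rintro (i | i) (j | j)
    · by_cases hi : (i : ℕ) < k
      · simp only [chainVec, Sum.elim_inl, if_pos hi, Sum.inl.injEq, Fin.ext_iff]
        rw [hB, h.B_x_y _ (by omega) _ hi]
        simp only [eq_comm]
      · simp only [chainVec, Sum.elim_inl, if_neg hi, Sum.inl.injEq, Fin.ext_iff]
        rw [hψx _ (by omega)]
        congr 1
        apply propext
        omega
    · by_cases hi : (i : ℕ) < k
      · simp [chainVec, hi, h.B_y_y]
      · simp [chainVec, hi, hψy]
    · simp only [chainVec, Sum.elim_inl, Sum.elim_inr, reduceCtorEq, if_false]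
      rw [h.B_x_x _ (by omega) _ (by omega), if_neg (by omega)]
    · simp only [chainVec, Sum.elim_inr, Sum.inr.injEq, Fin.ext_iff]
      rw [h.B_x_y _ (by omega) _ (by omega)]
  · intro v hv
    have h1 : ∀ j < k, B (x j) v = 0 := fun j hj => hv (Sum.inr ⟨j, hj⟩)
    have h2 : ∀ j < k, B (y j) v = 0 := fun j hj => by
      simpa [hj] using hv (Sum.inl ⟨j, by omega⟩)
    have h3 : ψ v = 0 := by simpa using hv (Sum.inl ⟨k, by omega⟩)
    rintro (⟨i, hi⟩ | ⟨j, hj⟩)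
    · constructor
      · change A (x i) v = 0
        rcases i with _ | i
        · rw [h.A_zero, LinearMap.zero_apply]
        · rw [h.A_succ i (by omega), h1 i (by omega)]
      · change B (x i) v = 0
        rcases (Nat.lt_succ_iff.1 hi).lt_or_eq with hi | rfl
        · exact h1 i hi
        · exact (hψ v h3).1
    · refine ⟨?_, h2 j hj⟩
      change A (y j) v = 0
      rcases (Nat.succ_le_iff.2 hj).lt_or_eq with hj | hj
      · rw [← neg_eq_zero, ← LinearMap.neg_apply, ← h.B_succ j hj, h2 _ hj]
      · exact (hψ v h3).2 j hj

theorem exists_basis_of_biorthogonal [FiniteDimensional F V] {ι : Type*} [Fintype ι]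
    [DecidableEq ι] (e : ι → V) (φ : ι → V →ₗ[F] F)
    (hφ : ∀ i j, φ i (e j) = if i = j then 1 else 0) :
    ∃ (m : ℕ) (b : Module.Basis (ι ⊕ Fin m) F V), (∀ i, b (Sum.inl i) = e i) ∧
      ∀ i j, φ i (b (Sum.inr j)) = 0 := by
  let C : Submodule F V := LinearMap.ker (LinearMap.pi φ)
  have hC : ∀ v, v ∈ C ↔ ∀ i, φ i v = 0 := fun v => by
    rw [LinearMap.mem_ker, funext_iff]
    rfl
  let c := Module.finBasis F C
  have hli : LinearIndependent F (Sum.elim e fun j => (c j : V)) := by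
    rw [Fintype.linearIndependent_iff]
    intro g hg
    rw [Fintype.sum_sum_type] at hg
    simp only [Sum.elim_inl, Sum.elim_inr] at hg
    have h1 : ∀ i, g (Sum.inl i) = 0 := by
      intro i
      have := congrArg (φ i) hg
      simpa [hφ, (hC _).1 (c _).2 i] using this
    have h2 : ∑ j, g (Sum.inr j) • c j = 0 := by
      apply Subtype.ext
      simpa [h1] using hg
    rintro (i | j)
    · exact h1 i
    · exact Fintype.linearIndependent_iff.1 c.linearIndependent _ h2 j
  refine ⟨_, Module.Basis.mk hli ?_, fun i => by rw [Module.Basis.mk_apply]; rfl, fun i j => ?_⟩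
  · intro v _
    have hv : v - ∑ i, φ i v • e i ∈ C := by
      rw [hC]
      intro i
      simp [hφ]
    have hc := c.sum_repr ⟨_, hv⟩
    have hc' := congrArg Subtype.val hc
    rw [eq_comm, sub_eq_iff_eq_add] at hc'
    rw [hc']
    simp only [Submodule.coe_sum, Submodule.coe_smul]
    exact add_mem (Submodule.sum_mem _ fun j _ => Submodule.smul_mem _ _
      (Submodule.subset_span ⟨Sum.inr j, rfl⟩)) (Submodule.sum_mem _ fun i _ =>
        Submodule.smul_mem _ _ (Submodule.subset_span ⟨Sum.inl i, rfl⟩))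
  · rw [Module.Basis.mk_apply]
    exact (hC _).1 (c j).2 i

/-- The Gram matrix of `A + B` on an odd chain. -/
def oddMat (γ : F) (k : ℕ) : Matrix (Fin (k + 1) ⊕ Fin k) (Fin (k + 1) ⊕ Fin k) F :=
  Matrix.fromBlocks (Matrix.of fun i j => if (i : ℕ) = k ∧ (j : ℕ) = k then γ else 0)
    (Matrix.of fun i j => (if (i : ℕ) = j then 1 else 0) + if (i : ℕ) = j + 1 then 1 else 0)
    (Matrix.of fun j i => (if (i : ℕ) = j then 1 else 0) - if (i : ℕ) = j + 1 then 1 else 0) 0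

theorem OddChain.add_apply_chainVec {A B : V →ₗ[F] V →ₗ[F] F}
    (hA : ∀ v, A v v = 0) (hB : ∀ v w, B v w = B w v) {γ : F} {k : ℕ} {x y : ℕ → V}
    (h : OddChain A B γ k x y) (i j : Fin (k + 1) ⊕ Fin k) :
    A (chainVec k x y i) (chainVec k x y j) + B (chainVec k x y i) (chainVec k x y j) =
      oddMat γ k i j := by
  have hAs := apply_eq_neg_apply_of_alternating hA
  have hAxx : ∀ i ≤ k, ∀ j ≤ k, A (x i) (x j) = 0 := by
    rintro (_ | i) hi j hj
    · rw [h.A_zero, LinearMap.zero_apply]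
    · rw [h.A_succ i hi, h.B_x_x _ (by omega) _ hj, if_neg (by omega)]
  have hAxy : ∀ i ≤ k, ∀ j < k, A (x i) (y j) = if i = j + 1 then 1 else 0 := by
    rintro (_ | i) hi j hj
    · rw [h.A_zero, LinearMap.zero_apply, if_neg (by omega)]
    · rw [h.A_succ i hi, h.B_x_y _ (by omega) _ hj]
      simp
  have hAyy' : ∀ j < k, ∀ i < j, A (y i) (y j) = 0 := by
    intro j hj i hi
    rw [← neg_eq_zero, ← LinearMap.neg_apply, ← h.B_succ i (by omega),
      h.B_y_y _ (by omega) _ hj]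
  have hAyy : ∀ i < k, ∀ j < k, A (y i) (y j) = 0 := by
    intro i hi j hj
    rcases lt_trichotomy i j with hij | rfl | hij
    · exact hAyy' j hj i hij
    · exact hA _
    · rw [hAs, hAyy' i hi j hij, neg_zero]
  rcases i with i | i <;> rcases j with j | j
  · simp only [chainVec, Sum.elim_inl, oddMat, fromBlocks_apply₁₁, of_apply]
    rw [hAxx _ (by omega) _ (by omega), h.B_x_x _ (by omega) _ (by omega), zero_add]
  · simp only [chainVec, Sum.elim_inl, Sum.elim_inr, oddMat, fromBlocks_apply₁₂, of_apply]
    rw [hAxy _ (by omega) _ (by omega), h.B_x_y _ (by omega) _ (by omega), add_comm]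
  · simp only [chainVec, Sum.elim_inl, Sum.elim_inr, oddMat, fromBlocks_apply₂₁, of_apply]
    rw [hAs, hB, hAxy _ (by omega) _ (by omega), h.B_x_y _ (by omega) _ (by omega)]
    ring
  · simp only [chainVec, Sum.elim_inr, oddMat, fromBlocks_apply₂₂, Matrix.zero_apply]
    rw [hAyy _ (by omega) _ (by omega), h.B_y_y _ (by omega) _ (by omega), zero_add]

/-- If the pencil spanned by `A` and `B` has kernels of dimension at most one and, for `γ ≠ 0`,
is singular only at `A`, then an odd chain spans the whole space. -/
theorem OddChain.finrank_eq [IsAlgClosed F] [FiniteDimensional F V] {A B : V →ₗ[F] V →ₗ[F] F}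
    (hA : ∀ v, A v v = 0) (hB : ∀ v w, B v w = B w v) {γ : F} {k : ℕ} {x y : ℕ → V}
    (h : OddChain A B γ k x y)
    (hker : ∀ p q : F, (p ≠ 0 ∨ q ≠ 0) → ∀ u v, p • B u + q • A u = 0 → p • B v + q • A v = 0 →
      u ≠ 0 → ∃ c : F, v = c • u)
    (hγ : γ ≠ 0 → ∀ μ : F, ∀ v, B v = μ • A v → v = 0) :
    Module.finrank F V = 2 * k + 1 := by
  have hAs := apply_eq_neg_apply_of_alternating hA
  obtain ⟨φ, hφ, hφ0⟩ := h.exists_dual hA hB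
  let C : Submodule F V := LinearMap.ker (LinearMap.pi φ)
  have hC : ∀ v, v ∈ C ↔ ∀ i, φ i v = 0 := fun v => by
    rw [LinearMap.mem_ker, funext_iff]
    rfl
  have hsub : ∀ v, v - ∑ i, φ i v • chainVec k x y i ∈ C := by
    intro v
    rw [hC]
    intro i
    simp [hφ, -Fintype.sum_sum_type]
  have hext : ∀ v ∈ C, ∀ a b : F, (∀ w ∈ C, a * B v w + b * A v w = 0) → a • B v + b • A v = 0 := by
    intro v hv a b hw
    have h0 := hφ0 v ((hC v).1 hv)
    refine LinearMap.ext fun w => ?_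
    have h1 := hw _ (hsub w)
    have h2 : ∀ i, A v (chainVec k x y i) = 0 := fun i => by rw [hAs, (h0 i).1, neg_zero]
    have h3 : ∀ i, B v (chainVec k x y i) = 0 := fun i => by rw [hB, (h0 i).2]
    simpa [h2, h3] using h1
  have hx0 : φ (Sum.inl 0) (x 0) = 1 := by
    simpa [chainVec] using hφ (Sum.inl 0) (Sum.inl 0)
  have hnontriv : ¬ Nontrivial C := by
    intro hnt
    let AC : C →ₗ[F] Module.Dual F C := A.compl₁₂ C.subtype C.subtype
    let BC : C →ₗ[F] Module.Dual F C := B.compl₁₂ C.subtype C.subtype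
    have hinj : Function.Injective AC := by
      rw [injective_iff_map_eq_zero]
      intro v hv
      have h1 := hext v v.2 0 1 fun w hw => by
        rw [zero_mul, one_mul, zero_add]
        exact LinearMap.congr_fun hv ⟨w, hw⟩
      obtain ⟨c, hc⟩ := hker 0 1 (by simp) (x 0) v (by simp [h.A_zero]) h1 h.ne_zero
      have h2 := (hC v).1 v.2 (Sum.inl 0)
      rw [hc, map_smul, hx0, smul_eq_mul, mul_one] at h2
      apply Subtype.ext
      rw [hc, h2, zero_smul]
      rfl
    let E : C ≃ₗ[F] Module.Dual F C :=
      LinearEquiv.ofInjectiveOfFinrankEq AC hinj Subspace.dual_finrank_eq.symm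
    obtain ⟨μ, hμ⟩ := Module.End.exists_eigenvalue (E.symm.toLinearMap ∘ₗ BC)
    obtain ⟨v, hv⟩ := hμ.exists_hasEigenvector
    have h1 : BC v = μ • AC v := by
      have h := congrArg E hv.apply_eq_smul
      rw [LinearMap.comp_apply, LinearEquiv.coe_coe, E.apply_symm_apply, map_smul] at h
      exact h
    have h2 := hext v v.2 1 (-μ) fun w hw => by
      have := LinearMap.congr_fun h1 ⟨w, hw⟩
      simp only [AC, BC, LinearMap.compl₁₂_apply, Submodule.subtype_apply, LinearMap.smul_apply,
        smul_eq_mul] at this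
      linear_combination this
    have hv0 : (v : V) ≠ 0 := fun h0 => hv.2 (Subtype.ext h0)
    by_cases hγ0 : γ = 0
    · let u := ∑ i ∈ Finset.range (k + 1), μ ^ (k - i) • x i
      have hu : (1 : F) • B u + (-μ) • A u = 0 := by
        have hBu : B u = ∑ i ∈ Finset.range k, μ ^ (k - i) • B (x i) := by
          simp only [u, Finset.sum_range_succ, map_add, map_sum, map_smul, h.B_last hγ0,
            smul_zero, add_zero]
        have hAu : A u = ∑ i ∈ Finset.range k, μ ^ (k - (i + 1)) • B (x i) := by
          simp only [u, Finset.sum_range_succ', map_add, map_sum, map_smul, h.A_zero,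
            smul_zero, add_zero]
          exact Finset.sum_congr rfl fun i hi => by rw [h.A_succ i (Finset.mem_range.1 hi)]
        rw [hBu, hAu, Finset.smul_sum, Finset.smul_sum, ← Finset.sum_add_distrib]
        refine Finset.sum_eq_zero fun i hi => ?_
        have := Finset.mem_range.1 hi
        rw [smul_smul, smul_smul, ← add_smul, show k - i = k - (i + 1) + 1 by omega]
        rw [show (1 : F) * μ ^ (k - (i + 1) + 1) + -μ * μ ^ (k - (i + 1)) = 0 by ring, zero_smul]
      have hφu : φ (Sum.inl (Fin.last k)) u = 1 := by
        rw [map_sum, Finset.sum_range_succ]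
        have h1 : ∀ i ≤ k, φ (Sum.inl (Fin.last k)) (x i) = if k = i then 1 else 0 := by
          intro i hi
          simpa [chainVec, Fin.ext_iff] using
            hφ (Sum.inl (Fin.last k)) (Sum.inl ⟨i, Nat.lt_succ_of_le hi⟩)
        rw [Finset.sum_eq_zero, map_smul, h1 k le_rfl]
        · simp
        · intro i hi
          have := Finset.mem_range.1 hi
          rw [map_smul, h1 i this.le, if_neg (by omega), smul_zero]
      have hu0 : u ≠ 0 := by
        intro h0
        simp [h0] at hφu
      obtain ⟨c, hc⟩ := hker 1 (-μ) (by simp) u v hu h2 hu0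
      have h3 := (hC v).1 v.2 (Sum.inl (Fin.last k))
      rw [hc, map_smul, hφu, smul_eq_mul, mul_one] at h3
      rw [h3, zero_smul] at hc
      exact hv0 hc
    · refine hv0 (hγ hγ0 μ v ?_)
      refine LinearMap.ext fun w => ?_
      have h3 := LinearMap.congr_fun h2 w
      simp only [LinearMap.add_apply, LinearMap.smul_apply, smul_eq_mul,
        LinearMap.zero_apply] at h3 ⊢
      linear_combination h3
  have hC0 : ∀ v, (∀ i, φ i v = 0) → v = 0 := by
    intro v hv
    by_contra hv0
    exact hnontriv ⟨⟨⟨v, (hC v).2 hv⟩, 0, fun h0 => hv0 (congrArg Subtype.val h0)⟩⟩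
  obtain ⟨m, b, hb1, hb2⟩ := exists_basis_of_biorthogonal _ φ hφ
  have hm : m = 0 := by
    by_contra hm
    exact b.ne_zero (Sum.inr ⟨0, by omega⟩) (hC0 _ fun i => hb2 i _)
  rw [Module.finrank_eq_card_basis b, hm]
  simp
  omega

end OddChain

section Cong

variable {α β δ : Type*} [Fintype α] [Fintype β] [DecidableEq α] [DecidableEq β]

/-- Congruence of square matrices with arbitrary finite index types. -/
def Cong (M : Matrix α α F) (N : Matrix β β F) : Prop :=
  ∃ (P : Matrix α β F) (Q : Matrix β α F), P * Q = 1 ∧ Q * P = 1 ∧ Pᵀ * M * P = N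

theorem Cong.symm {M : Matrix α α F} {N : Matrix β β F} (h : Cong M N) : Cong N M := by
  obtain ⟨P, Q, h1, h2, rfl⟩ := h
  refine ⟨Q, P, h2, h1, ?_⟩
  calc Qᵀ * (Pᵀ * M * P) * Q = (P * Q)ᵀ * M * (P * Q) := by
        rw [transpose_mul]; simp only [Matrix.mul_assoc]
    _ = M := by rw [h1, transpose_one, Matrix.one_mul, Matrix.mul_one]

theorem Cong.trans [Fintype δ] [DecidableEq δ] {M : Matrix α α F} {N : Matrix β β F}
    {L : Matrix δ δ F} (h : Cong M N) (h' : Cong N L) : Cong M L := by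
  obtain ⟨P, Q, h1, h2, rfl⟩ := h
  obtain ⟨P', Q', h1', h2', rfl⟩ := h'
  refine ⟨P * P', Q' * Q, ?_, ?_, ?_⟩
  · rw [Matrix.mul_assoc, ← Matrix.mul_assoc P', h1', Matrix.one_mul, h1]
  · rw [Matrix.mul_assoc, ← Matrix.mul_assoc Q, h2, Matrix.one_mul, h2']
  · rw [transpose_mul]
    simp only [Matrix.mul_assoc]

theorem Cong.fromBlocks [Fintype δ] [DecidableEq δ] {M : Matrix α α F} {N : Matrix β β F}
    (h : Cong M N) (D : Matrix δ δ F) : Cong (fromBlocks M 0 0 D) (fromBlocks N 0 0 D) := by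
  obtain ⟨P, Q, h1, h2, rfl⟩ := h
  refine ⟨Matrix.fromBlocks P 0 0 1, Matrix.fromBlocks Q 0 0 1, ?_, ?_, ?_⟩ <;>
  simp [fromBlocks_transpose, fromBlocks_multiply, h1, h2]

theorem cong_reindex (e : α ≃ β) (M : Matrix α α F) : Cong M (reindex e e M) := by
  refine ⟨(1 : Matrix α α F).submatrix id e.symm, (1 : Matrix α α F).submatrix e.symm id,
    ?_, ?_, ?_⟩
  · rw [submatrix_mul_equiv]; simp
  · rw [← submatrix_mul _ _ _ _ _ Function.bijective_id]; simp
  · rw [transpose_submatrix, transpose_one]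
    ext i j
    simp [Matrix.mul_apply, Matrix.one_apply, Matrix.submatrix_apply]

theorem Cong.matCongruent {n : ℕ} {M N : Matrix (Fin n) (Fin n) F} (h : Cong M N) :
    MatCongruent M N := by
  obtain ⟨P, Q, h1, h2, h3⟩ := h
  exact ⟨P, IsUnit.of_mul_eq_one Q h1, h3⟩

theorem Cong.congSummand {n r m : ℕ} {M : Matrix (Fin n) (Fin n) F} {G : Matrix (Fin r) (Fin r) F}
    {D : Matrix (Fin m) (Fin m) F} (hn : r + m = n) (h : Cong M (Matrix.fromBlocks G 0 0 D)) :
    CongSummand M G :=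
  ⟨m, hn, D, ((h.trans (cong_reindex finSumFinEquiv _)).trans
    (cong_reindex (finCongr hn) _)).matCongruent⟩

end Cong

section Forms

variable {n : ℕ}

/-- The alternating bilinear form attached to a square matrix. -/
def altForm (M : Matrix (Fin n) (Fin n) F) : (Fin n → F) →ₗ[F] (Fin n → F) →ₗ[F] F :=
  Matrix.toLinearMap₂' F (M - Mᵀ)

/-- The symmetric bilinear form attached to a square matrix. -/
def symForm (M : Matrix (Fin n) (Fin n) F) : (Fin n → F) →ₗ[F] (Fin n → F) →ₗ[F] F :=
  Matrix.toLinearMap₂' F (M + Mᵀ)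

theorem altForm_apply (M : Matrix (Fin n) (Fin n) F) (v w : Fin n → F) :
    altForm M v w = v ⬝ᵥ M *ᵥ w - w ⬝ᵥ M *ᵥ v := by
  rw [altForm, Matrix.toLinearMap₂'_apply', sub_mulVec, dotProduct_sub, mulVec_transpose,
    dotProduct_comm v (w ᵥ* M), ← dotProduct_mulVec]

theorem symForm_apply (M : Matrix (Fin n) (Fin n) F) (v w : Fin n → F) :
    symForm M v w = v ⬝ᵥ M *ᵥ w + w ⬝ᵥ M *ᵥ v := by
  rw [symForm, Matrix.toLinearMap₂'_apply', add_mulVec, dotProduct_add, mulVec_transpose,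
    dotProduct_comm v (w ᵥ* M), ← dotProduct_mulVec]

theorem altForm_self (M : Matrix (Fin n) (Fin n) F) (v : Fin n → F) : altForm M v v = 0 := by
  rw [altForm_apply, sub_self]

theorem symForm_comm (M : Matrix (Fin n) (Fin n) F) (v w : Fin n → F) :
    symForm M v w = symForm M w v := by
  rw [symForm_apply, symForm_apply, add_comm]

theorem exists_oddChain_of_isometry [IsAlgClosed F] (hchar : (2 : F) ≠ 0)
    {M S : Matrix (Fin n) (Fin n) F} (hS : Sᵀ * M * S = M) (h0 : S.det ≠ 0) (h1 : S.det ≠ 1) :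
    ∃ γ k x y, OddChain (altForm M) (symForm M) γ k x y := by
  have hT : ∀ v w, (S *ᵥ v) ⬝ᵥ M *ᵥ (S *ᵥ w) = v ⬝ᵥ M *ᵥ w := by
    intro v w
    rw [← vecMul_transpose, ← dotProduct_mulVec, mulVec_mulVec, mulVec_mulVec, hS]
  refine exists_oddChain hchar _ _ (altForm M) (symForm M) (Matrix.toLin' S) le_rfl (altForm_self M)
    (symForm_comm M) (fun v w => ?_) (fun v w => ?_) ?_ ?_
  · rw [altForm_apply, altForm_apply, toLin'_apply, toLin'_apply, hT, hT]
  · rw [symForm_apply, symForm_apply, toLin'_apply, toLin'_apply, hT, hT]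
  · rwa [LinearMap.det_toLin']
  · rwa [LinearMap.det_toLin']

theorem OddChain.cong (hchar : (2 : F) ≠ 0) {M : Matrix (Fin n) (Fin n) F} {γ : F} {k : ℕ}
    {x y : ℕ → Fin n → F} (h : OddChain (altForm M) (symForm M) γ k x y) :
    ∃ (m : ℕ) (D : Matrix (Fin m) (Fin m) F), 2 * k + 1 + m = n ∧
      Cong M (fromBlocks ((2⁻¹ : F) • oddMat γ k) 0 0 D) := by
  have hA := altForm_self M
  have hB := symForm_comm M
  have hAB : ∀ v w, v ⬝ᵥ M *ᵥ w = 2⁻¹ * (altForm M v w + symForm M v w) := by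
    intro v w
    rw [altForm_apply, symForm_apply]
    field_simp
    ring
  obtain ⟨φ, hφ, hφ0⟩ := h.exists_dual hA hB
  obtain ⟨m, b, hb1, hb2⟩ := exists_basis_of_biorthogonal _ φ hφ
  let c := Pi.basisFun F (Fin n)
  have hP : ∀ i j, ((c.toMatrix b)ᵀ * M * c.toMatrix b) i j = b i ⬝ᵥ M *ᵥ b j := by
    intro i j
    rw [Matrix.mul_assoc]
    simp only [Matrix.mul_apply, dotProduct, mulVec, transpose_apply]
    rfl
  have hAs := apply_eq_neg_apply_of_alternating hA
  refine ⟨m, of fun i j => b (Sum.inr i) ⬝ᵥ M *ᵥ b (Sum.inr j), ?_, c.toMatrix b, b.toMatrix c,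
    c.toMatrix_mul_toMatrix_flip b, b.toMatrix_mul_toMatrix_flip c, ?_⟩
  · have := Module.finrank_eq_card_basis b
    simp at this
    omega
  · ext (i | i) (j | j)
    · rw [hP, hAB, hb1, hb1, h.add_apply_chainVec hA hB]
      rfl
    · have := hφ0 _ (fun i => hb2 i j) i
      rw [hP, hAB, hb1, this.1, this.2]
      simp
    · have := hφ0 _ (fun j => hb2 j i) j
      rw [hP, hAB, hb1, hAs, hB, this.1, this.2]
      simp
    · rw [hP]
      rfl

end Forms

section Models

variable {n : ℕ}

/-- For `γ ≠ 0`, a vector which is left orthogonal to an odd chain for `A + B` is so for `B`. -/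
theorem OddChain.apply_eq_zero {V : Type u} [AddCommGroup V] [Module F V]
    {A B : V →ₗ[F] V →ₗ[F] F} (hA : ∀ v, A v v = 0) (hB : ∀ v w, B v w = B w v) {γ : F} {k : ℕ}
    {x y : ℕ → V} (h : OddChain A B γ k x y) (hγ : γ ≠ 0) {v : V}
    (hx : ∀ i ≤ k, A v (x i) + B v (x i) = 0) (hy : ∀ j < k, A v (y j) + B v (y j) = 0) :
    (∀ i ≤ k, B v (x i) = 0) ∧ ∀ j < k, B v (y j) = 0 := by
  have hAs := apply_eq_neg_apply_of_alternating hA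
  have h1 : ∀ i ≤ k, B v (x i) = 0 := by
    intro i
    induction i with
    | zero =>
      intro hi
      have := hx 0 hi
      rwa [hAs, h.A_zero, LinearMap.zero_apply, neg_zero, zero_add] at this
    | succ i ih =>
      intro hi
      have := hx _ hi
      rwa [hAs, h.A_succ i (by omega), hB, ih (by omega), neg_zero, zero_add] at this
  have h2 : ∀ d j, j + 1 + d = k → B v (y j) = 0 := by
    intro d
    induction d with
    | zero =>
      intro j hj
      have h3 := hy j (by omega)
      have h4 := LinearMap.congr_fun (h.B_last_eq j hj) v
      rw [hB, h1 k le_rfl, LinearMap.smul_apply, smul_eq_mul, eq_comm, mul_eq_zero] at h4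
      rwa [hAs, h4.resolve_left (neg_ne_zero.2 hγ), neg_zero, zero_add] at h3
    | succ d ih =>
      intro j hj
      have h3 := hy j (by omega)
      have h4 := LinearMap.congr_fun (h.B_succ j (by omega)) v
      rw [hB, ih (j + 1) (by omega), LinearMap.neg_apply] at h4
      rwa [hAs, ← h4, zero_add] at h3
  exact ⟨h1, fun j hj => h2 (k - (j + 1)) j (by omega)⟩

/-- Extension of a vector by zero. -/
def extendZero (v : Fin n → F) (i : ℕ) : F := if h : i < n then v ⟨i, h⟩ else 0

theorem extendZero_coe (v : Fin n → F) (i : Fin n) : extendZero v i = v i := dif_pos i.2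

theorem extendZero_of_le (v : Fin n → F) {i : ℕ} (h : n ≤ i) : extendZero v i = 0 :=
  dif_neg (by omega)

theorem sum_extendZero_mul_ite (v : Fin n → F) (a : ℕ) :
    ∑ i : Fin n, v i * (if (i : ℕ) = a then 1 else 0) = extendZero v a := by
  by_cases h : a < n
  · rw [Finset.sum_eq_single ⟨a, h⟩]
    · simp [extendZero, h]
    · intro i _ hi
      rw [if_neg fun h => hi (Fin.ext h), mul_zero]
    · simp
  · rw [extendZero_of_le v (by omega)]
    exact Finset.sum_eq_zero fun i _ => by rw [if_neg (by omega), mul_zero]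

theorem vecMul_jordanBlock (v : Fin n → F) (j : Fin n) :
    (v ᵥ* jordanBlock n (0 : F)) j = extendZero v (j + 1) := by
  rw [vecMul, dotProduct, ← sum_extendZero_mul_ite]
  refine Finset.sum_congr rfl fun i _ => ?_
  simp only [jordanBlock, of_apply]
  split_ifs <;> first | rfl | omega

theorem jordanBlock_mulVec_zero (v : Fin n → F) (h : 0 < n) :
    (jordanBlock n (0 : F) *ᵥ v) ⟨0, h⟩ = 0 := by
  rw [mulVec, dotProduct]
  exact Finset.sum_eq_zero fun i _ => by simp [jordanBlock]

theorem jordanBlock_mulVec_succ (v : Fin n → F) (j : ℕ) (h : j + 1 < n) :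
    (jordanBlock n (0 : F) *ᵥ v) ⟨j + 1, h⟩ = extendZero v j := by
  rw [mulVec, dotProduct, ← sum_extendZero_mul_ite]
  refine Finset.sum_congr rfl fun i _ => ?_
  simp only [jordanBlock, of_apply]
  rw [mul_comm]
  congr 1
  split_ifs <;> first | rfl | omega

theorem vecMul_Gam (K : ℕ) (v : Fin (2 * K + 1) → F) (j : Fin (2 * K + 1)) :
    (v ᵥ* Gam (2 * K + 1)) j =
      (-1) ^ (j : ℕ) * (extendZero v (2 * K - j) - extendZero v (2 * K + 1 - j)) := by
  rw [vecMul, dotProduct, ← sum_extendZero_mul_ite, ← sum_extendZero_mul_ite,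
    ← Finset.sum_sub_distrib, Finset.mul_sum]
  refine Finset.sum_congr rfl fun i _ => ?_
  simp only [Gam, of_apply]
  have hi := i.2
  have hj := j.2
  rcases eq_or_ne (i : ℕ) (2 * K - j) with h1 | h1
  · rw [if_pos (by omega), if_pos h1, if_neg (by omega),
      show 2 * K + 1 - 1 - (i : ℕ) = j by omega]
    ring
  · rcases eq_or_ne (i : ℕ) (2 * K + 1 - j) with h2 | h2
    · rw [if_pos (by omega), if_neg h1, if_pos h2,
        show (j : ℕ) = (2 * K + 1 - 1 - i) + 1 by omega]
      ring
    · rw [if_neg (by omega), if_neg h1, if_neg h2]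
      ring

theorem Gam_mulVec (K : ℕ) (v : Fin (2 * K + 1) → F) (j : Fin (2 * K + 1)) :
    (Gam (2 * K + 1) *ᵥ v) j =
      (-1) ^ (j : ℕ) * (extendZero v (2 * K - j) + extendZero v (2 * K + 1 - j)) := by
  rw [mulVec, dotProduct, ← sum_extendZero_mul_ite, ← sum_extendZero_mul_ite,
    ← Finset.sum_add_distrib, Finset.mul_sum]
  refine Finset.sum_congr rfl fun i _ => ?_
  simp only [Gam, of_apply]
  have hi := i.2
  have hj := j.2
  have hs : (-1 : F) ^ (2 * K + 1 - 1 - (j : ℕ)) = (-1) ^ (j : ℕ) := by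
    refine neg_one_pow_congr ?_
    rw [Nat.even_iff, Nat.even_iff]
    omega
  rw [hs]
  rcases eq_or_ne (i : ℕ) (2 * K - j) with h1 | h1
  · rw [if_pos (by omega), if_pos h1, if_neg (by omega)]
    ring
  · rcases eq_or_ne (i : ℕ) (2 * K + 1 - j) with h2 | h2
    · rw [if_pos (by omega), if_neg h1, if_pos h2]
      ring
    · rw [if_neg (by omega), if_neg h1, if_neg h2]
      ring

theorem smul_symForm_add_smul_altForm (M : Matrix (Fin n) (Fin n) F) (p q : F) (v : Fin n → F) :
    p • symForm M v + q • altForm M v = 0 ↔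
      ∀ j, (p + q) * (v ᵥ* M) j + (p - q) * (M *ᵥ v) j = 0 := by
  have h : ∀ w, (p • symForm M v + q • altForm M v) w =
      ((p + q) • (v ᵥ* M) + (p - q) • (M *ᵥ v)) ⬝ᵥ w := by
    intro w
    simp only [LinearMap.add_apply, LinearMap.smul_apply, symForm_apply, altForm_apply,
      add_dotProduct, smul_dotProduct, smul_eq_mul]
    rw [← dotProduct_mulVec, dotProduct_comm (M *ᵥ v)]
    ring
  constructor
  · intro h0 j
    have h1 := h (Pi.single j 1)
    rw [h0, LinearMap.zero_apply, dotProduct_single, mul_one] at h1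
    exact h1.symm
  · intro h0
    refine LinearMap.ext fun w => ?_
    rw [h]
    exact Finset.sum_eq_zero fun j _ => by
      rw [Pi.add_apply, Pi.smul_apply, Pi.smul_apply, smul_eq_mul, smul_eq_mul, h0, zero_mul]

theorem exists_eq_smul_of_coord {P : (Fin n → F) → Prop}
    (hP : ∀ (c : F) u v, P u → P v → P (v - c • u)) (i : Fin n)
    (hi : ∀ v, P v → v i = 0 → v = 0) {u v : Fin n → F} (hu : P u) (hv : P v)
    (hu0 : u ≠ 0) : ∃ c : F, v = c • u := by
  have h0 : u i ≠ 0 := fun h => hu0 (hi u hu h)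
  refine ⟨v i / u i, sub_eq_zero.1 (hi _ (hP _ u v hu hv) ?_)⟩
  simp [h0]

theorem pencil_sub_smul (M : Matrix (Fin n) (Fin n) F) (p q c : F) (u v : Fin n → F)
    (hu : p • symForm M u + q • altForm M u = 0) (hv : p • symForm M v + q • altForm M v = 0) :
    p • symForm M (v - c • u) + q • altForm M (v - c • u) = 0 := by
  calc _ = (p • symForm M v + q • altForm M v) - c • (p • symForm M u + q • altForm M u) := by
        simp only [map_sub, map_smul]
        module
    _ = 0 := by rw [hu, hv, smul_zero, sub_zero]

theorem Gam_pencil (hchar : (2 : F) ≠ 0) {K : ℕ} {p q : F} {v : Fin (2 * K + 1) → F}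
    (hv : p • symForm (Gam (2 * K + 1)) v + q • altForm (Gam (2 * K + 1)) v = 0) :
    ∀ i ≤ 2 * K, p * extendZero v i = q * extendZero v (i + 1) := by
  rw [smul_symForm_add_smul_altForm] at hv
  intro i hi
  have h := hv ⟨2 * K - i, by omega⟩
  rw [vecMul_Gam, Gam_mulVec] at h
  simp only at h
  rw [show 2 * K - (2 * K - i) = i by omega, show 2 * K + 1 - (2 * K - i) = i + 1 by omega] at h
  have h2 : (2 * (-1) ^ (2 * K - i) : F) * (p * extendZero v i - q * extendZero v (i + 1)) = 0 := by
    linear_combination h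
  exact sub_eq_zero.1 ((mul_eq_zero.1 h2).resolve_left (by simp [hchar]))

theorem Gam_pencil_eq_zero (hchar : (2 : F) ≠ 0) {K : ℕ} {p q : F} (hp : p ≠ 0)
    {v : Fin (2 * K + 1) → F}
    (hv : p • symForm (Gam (2 * K + 1)) v + q • altForm (Gam (2 * K + 1)) v = 0) : v = 0 := by
  have h := Gam_pencil hchar hv
  have h1 : ∀ d i, i + d = 2 * K + 1 → extendZero v i = 0 := by
    intro d
    induction d with
    | zero => exact fun i hi => extendZero_of_le v (by omega)
    | succ d ih =>
      intro i hi
      have h2 := h i (by omega)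
      rw [ih (i + 1) (by omega), mul_zero] at h2
      exact (mul_eq_zero.1 h2).resolve_left hp
  funext i
  rw [← extendZero_coe v i, h1 (2 * K + 1 - i) i (by omega)]
  rfl

theorem Gam_pencil_ker (hchar : (2 : F) ≠ 0) (K : ℕ) (p q : F) (hpq : p ≠ 0 ∨ q ≠ 0)
    (u v : Fin (2 * K + 1) → F)
    (hu : p • symForm (Gam (2 * K + 1)) u + q • altForm (Gam (2 * K + 1)) u = 0)
    (hv : p • symForm (Gam (2 * K + 1)) v + q • altForm (Gam (2 * K + 1)) v = 0) (hu0 : u ≠ 0) :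
    ∃ c : F, v = c • u := by
  by_cases hp : p = 0
  · refine exists_eq_smul_of_coord (pencil_sub_smul _ p q) 0 (fun w hw hw0 => ?_) hu hv hu0
    have h := Gam_pencil hchar hw
    funext ⟨i, hi⟩
    rcases i with _ | i
    · exact hw0
    · have h1 := h i (by omega)
      rw [hp, zero_mul, eq_comm, mul_eq_zero] at h1
      have h2 := h1.resolve_left (hpq.resolve_left (not_not.2 hp))
      rwa [← extendZero_coe w ⟨i + 1, hi⟩]
  · exact absurd (Gam_pencil_eq_zero hchar hp hu) hu0

theorem jordanBlock_pencil {K : ℕ} {p q : F} {v : Fin (2 * K + 1) → F}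
    (hv : p • symForm (jordanBlock (2 * K + 1) (0 : F)) v +
      q • altForm (jordanBlock (2 * K + 1) (0 : F)) v = 0) :
    (p + q) * extendZero v 1 = 0 ∧
      ∀ j < 2 * K, (p + q) * extendZero v (j + 2) + (p - q) * extendZero v j = 0 := by
  rw [smul_symForm_add_smul_altForm] at hv
  constructor
  · have h := hv ⟨0, by omega⟩
    rwa [vecMul_jordanBlock, jordanBlock_mulVec_zero, mul_zero, add_zero] at h
  · intro j hj
    have h := hv ⟨j + 1, by omega⟩
    rwa [vecMul_jordanBlock, jordanBlock_mulVec_succ] at h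

theorem jordanBlock_pencil_odd {K : ℕ} {p q : F} (hpq : p + q ≠ 0) {v : Fin (2 * K + 1) → F}
    (hv : p • symForm (jordanBlock (2 * K + 1) (0 : F)) v +
      q • altForm (jordanBlock (2 * K + 1) (0 : F)) v = 0) (i : ℕ) :
    extendZero v (2 * i + 1) = 0 := by
  obtain ⟨h1, h2⟩ := jordanBlock_pencil hv
  induction i with
  | zero => exact (mul_eq_zero.1 h1).resolve_left hpq
  | succ i ih =>
    by_cases hi : 2 * i + 1 < 2 * K
    · have h := h2 _ hi
      rw [ih, mul_zero, add_zero] at h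
      exact (mul_eq_zero.1 h).resolve_left hpq
    · exact extendZero_of_le v (by omega)

theorem jordanBlock_pencil_ker (hchar : (2 : F) ≠ 0) (K : ℕ) (p q : F) (hpq : p ≠ 0 ∨ q ≠ 0)
    (u v : Fin (2 * K + 1) → F)
    (hu : p • symForm (jordanBlock (2 * K + 1) (0 : F)) u +
      q • altForm (jordanBlock (2 * K + 1) (0 : F)) u = 0)
    (hv : p • symForm (jordanBlock (2 * K + 1) (0 : F)) v +
      q • altForm (jordanBlock (2 * K + 1) (0 : F)) v = 0) (hu0 : u ≠ 0) :
    ∃ c : F, v = c • u := by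
  by_cases hα : p + q = 0
  · refine exists_eq_smul_of_coord (pencil_sub_smul _ p q) (Fin.last _) (fun w hw hw0 => ?_)
      hu hv hu0
    have hβ : p - q ≠ 0 := by
      intro hβ
      have hp : 2 * p = 0 := by linear_combination hα + hβ
      have hq : 2 * q = 0 := by linear_combination hα - hβ
      rw [mul_eq_zero, or_iff_right hchar] at hp hq
      exact hpq.elim (absurd hp) (absurd hq)
    obtain ⟨-, h⟩ := jordanBlock_pencil hw
    funext i
    by_cases hi : (i : ℕ) < 2 * K
    · have h1 := h i hi
      rw [hα, zero_mul, zero_add, mul_eq_zero] at h1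
      rw [← extendZero_coe w i, h1.resolve_left hβ]
      rfl
    · rwa [show i = Fin.last _ from Fin.ext (by simp; omega)]
  · refine exists_eq_smul_of_coord (pencil_sub_smul _ p q) 0 (fun w hw hw0 => ?_) hu hv hu0
    obtain ⟨-, h⟩ := jordanBlock_pencil hw
    have h0 : ∀ i, extendZero w (2 * i) = 0 := by
      intro i
      induction i with
      | zero => exact hw0
      | succ i ih =>
        by_cases hi : 2 * i < 2 * K
        · have h1 := h _ hi
          rw [ih, mul_zero, add_zero] at h1
          exact (mul_eq_zero.1 h1).resolve_left hα
        · exact extendZero_of_le w (by omega)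
    funext i
    rw [← extendZero_coe w i]
    rcases Nat.even_or_odd' (i : ℕ) with ⟨c, hc | hc⟩ <;> rw [hc]
    · exact h0 c
    · exact jordanBlock_pencil_odd hα hw c

theorem det_neg_one_ne_one (hchar : (2 : F) ≠ 0) (K : ℕ) :
    (-1 : Matrix (Fin (2 * K + 1)) (Fin (2 * K + 1)) F).det = -1 ∧ (-1 : F) ≠ 1 := by
  constructor
  · rw [det_neg, det_one, mul_one, Fintype.card_fin, pow_succ, pow_mul]
    simp
  · intro h
    exact hchar (by linear_combination -h)

theorem Gam_oddChain [IsAlgClosed F] (hchar : (2 : F) ≠ 0) (K : ℕ) :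
    ∃ x y, OddChain (altForm (Gam (2 * K + 1) : Matrix _ _ F)) (symForm (Gam (2 * K + 1))) 1 K
      x y := by
  obtain ⟨hd, hd1⟩ := det_neg_one_ne_one hchar K
  obtain ⟨γ, k, x, y, h⟩ := exists_oddChain_of_isometry hchar
    (M := (Gam (2 * K + 1) : Matrix _ _ F)) (S := -1) (by simp) (by rw [hd]; simp) (by rwa [hd])
  have hfin := h.finrank_eq (altForm_self _) (symForm_comm _) (Gam_pencil_ker hchar K)
    fun _ μ v hv => Gam_pencil_eq_zero hchar one_ne_zero (q := -μ) (by rw [hv]; module)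
  rw [Module.finrank_fin_fun] at hfin
  obtain rfl : k = K := by omega
  refine h.exists_normalized fun hγ => ?_
  have hx : x k = 0 := Gam_pencil_eq_zero hchar one_ne_zero (q := 0) (by simp [h.B_last hγ])
  obtain ⟨φ, hφ, -⟩ := h.exists_dual (altForm_self _) (symForm_comm _)
  have := hφ (Sum.inl (Fin.last k)) (Sum.inl (Fin.last k))
  simp [chainVec, hx] at this

theorem jordanBlock_oddChain [IsAlgClosed F] (hchar : (2 : F) ≠ 0) (K : ℕ) :
    ∃ x y, OddChain (altForm (jordanBlock (2 * K + 1) (0 : F)))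
      (symForm (jordanBlock (2 * K + 1) (0 : F))) 0 K x y := by
  obtain ⟨hd, hd1⟩ := det_neg_one_ne_one hchar K
  obtain ⟨γ, k, x, y, h⟩ := exists_oddChain_of_isometry hchar
    (M := jordanBlock (2 * K + 1) (0 : F)) (S := -1) (by simp) (by rw [hd]; simp) (by rwa [hd])
  have hγ : γ = 0 := by
    by_contra hγ
    let e : Fin (2 * K + 1) → Fin (2 * K + 1) → F := fun a => Pi.single a 1
    have hadd : ∀ (a : Fin (2 * K + 1)) w,
        altForm (jordanBlock (2 * K + 1) (0 : F)) (e a) w +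
          symForm (jordanBlock (2 * K + 1) (0 : F)) (e a) w =
        2 * (jordanBlock (2 * K + 1) (0 : F) *ᵥ w) a := by
      intro a w
      rw [altForm_apply, symForm_apply]
      simp only [e, single_one_dotProduct]
      ring
    have hsym : ∀ (a : Fin (2 * K + 1)) w,
        symForm (jordanBlock (2 * K + 1) (0 : F)) (e a) w =
        (jordanBlock (2 * K + 1) (0 : F) *ᵥ w) a + extendZero w (a + 1) := by
      intro a w
      rw [symForm_apply, dotProduct_mulVec w, dotProduct_single_one, vecMul_jordanBlock,
        single_one_dotProduct]
    have hchain : ∀ i (hi : 2 * i < 2 * K + 1),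
        (∀ j ≤ k, (jordanBlock (2 * K + 1) (0 : F) *ᵥ x j) ⟨2 * i, hi⟩ = 0) ∧
        (∀ j < k, (jordanBlock (2 * K + 1) (0 : F) *ᵥ y j) ⟨2 * i, hi⟩ = 0) := by
      intro i
      induction i with
      | zero => exact fun hi => ⟨fun j _ => jordanBlock_mulVec_zero _ hi,
          fun j _ => jordanBlock_mulVec_zero _ hi⟩
      | succ i ih =>
        intro hi
        obtain ⟨h1, h2⟩ := ih (by omega)
        obtain ⟨h3, h4⟩ := h.apply_eq_zero (altForm_self _) (symForm_comm _) hγ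
          (v := e ⟨2 * i, by omega⟩) (fun j hj => by rw [hadd, h1 j hj, mul_zero])
          (fun j hj => by rw [hadd, h2 j hj, mul_zero])
        constructor
        · intro j hj
          have h5 := h3 j hj
          rw [hsym, h1 j hj, zero_add] at h5
          exact (jordanBlock_mulVec_succ _ (2 * i + 1) hi).trans h5
        · intro j hj
          have h5 := h4 j hj
          rw [hsym, h2 j hj, zero_add] at h5
          exact (jordanBlock_mulVec_succ _ (2 * i + 1) hi).trans h5
    have hB : ∀ i (hi : 2 * i < 2 * K + 1),
        (∀ j ≤ k, symForm (jordanBlock (2 * K + 1) (0 : F)) (e ⟨2 * i, hi⟩) (x j) = 0) ∧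
        (∀ j < k, symForm (jordanBlock (2 * K + 1) (0 : F)) (e ⟨2 * i, hi⟩) (y j) = 0) := by
      intro i hi
      obtain ⟨h1, h2⟩ := hchain i hi
      exact h.apply_eq_zero (altForm_self _) (symForm_comm _) hγ
        (fun j hj => by rw [hadd, h1 j hj, mul_zero]) (fun j hj => by rw [hadd, h2 j hj, mul_zero])
    have hodd := jordanBlock_pencil_odd (p := 0) (q := 1) (by simp) (v := x 0)
      (by simp [h.A_zero])
    have hx0 : ∀ z, (∀ i (hi : 2 * i < 2 * K + 1),
        symForm (jordanBlock (2 * K + 1) (0 : F)) (e ⟨2 * i, hi⟩) z = 0) →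
        symForm (jordanBlock (2 * K + 1) (0 : F)) (x 0) z = 0 := by
      intro z hz
      have hsum := (Pi.basisFun F (Fin (2 * K + 1))).sum_repr (x 0)
      rw [← hsum, map_sum, LinearMap.sum_apply]
      refine Finset.sum_eq_zero fun a _ => ?_
      rw [map_smul, LinearMap.smul_apply, Pi.basisFun_repr, Pi.basisFun_apply]
      obtain ⟨a, ha⟩ := a
      rcases Nat.even_or_odd' a with ⟨c, rfl | rfl⟩
      · rw [show symForm _ (Pi.single _ 1) z = 0 from hz c ha, smul_zero]
      · rw [← extendZero_coe (x 0), hodd c, zero_smul]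
    rcases Nat.eq_zero_or_pos k with rfl | hk
    · have h1 := h.B_x_x 0 le_rfl 0 le_rfl
      rw [hx0 _ fun i hi => (hB i hi).1 0 le_rfl] at h1
      exact hγ (by simpa using h1.symm)
    · have h1 := h.B_x_y 0 (by omega) 0 hk
      rw [hx0 _ fun i hi => (hB i hi).2 0 hk] at h1
      simp at h1
  have hfin := h.finrank_eq (altForm_self _) (symForm_comm _) (jordanBlock_pencil_ker hchar K)
    fun hγ' => absurd hγ hγ'
  rw [Module.finrank_fin_fun] at hfin
  obtain rfl : k = K := by omega
  exact ⟨x, y, hγ ▸ h⟩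

theorem OddChain.cong_of_card_eq (hchar : (2 : F) ≠ 0) {γ : F} {k : ℕ}
    {M : Matrix (Fin (2 * k + 1)) (Fin (2 * k + 1)) F} {x y : ℕ → Fin (2 * k + 1) → F}
    (h : OddChain (altForm M) (symForm M) γ k x y) : Cong M ((2⁻¹ : F) • oddMat γ k) := by
  obtain ⟨m, D, hm, h⟩ := h.cong hchar
  obtain rfl : m = 0 := by omega
  have h2 := cong_reindex (Equiv.sumEmpty _ (Fin 0)) (fromBlocks ((2⁻¹ : F) • oddMat γ k) 0 0 D)
  exact h.trans h2

theorem OddChain.congSummand (hchar : (2 : F) ≠ 0) {γ : F} {k : ℕ}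
    {M : Matrix (Fin n) (Fin n) F} {x y : ℕ → Fin n → F}
    (h : OddChain (altForm M) (symForm M) γ k x y)
    {G : Matrix (Fin (2 * k + 1)) (Fin (2 * k + 1)) F} {x' y' : ℕ → Fin (2 * k + 1) → F}
    (h' : OddChain (altForm G) (symForm G) γ k x' y') : CongSummand M G := by
  obtain ⟨m, D, hm, h⟩ := h.cong hchar
  exact (h.trans ((h'.cong_of_card_eq hchar).symm.fromBlocks D)).congSummand hm

theorem not_xiMem_of_congSummand (hchar : (2 : F) ≠ 0) {M : Matrix (Fin n) (Fin n) F} {r : ℕ}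
    (hr : Odd r) {G : Matrix (Fin r) (Fin r) F} (h : CongSummand M G) : ¬ XiMem M := by
  obtain ⟨s, rfl, B, S, hS, hSM⟩ := h
  intro hM
  let E : Matrix (Fin (r + s)) (Fin (r + s)) F := dSum (-1) 1
  have hE : Eᵀ * (Sᵀ * M * S) * E = Sᵀ * M * S := by
    rw [hSM]
    simp [E, dSum, fromBlocks_multiply, fromBlocks_transpose]
  have hdet : E.det = -1 := by
    simp [E, dSum, hr.neg_one_pow, det_neg]
  have hSd : IsUnit S.det := (isUnit_iff_isUnit_det _).1 hS
  have h1 := hM (S * E * S⁻¹) ?_ ?_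
  · rw [det_mul, det_mul, mul_right_comm, ← det_mul, mul_nonsing_inv _ hSd, det_one, one_mul,
      hdet] at h1
    exact hchar (by linear_combination -h1)
  · rw [isUnit_iff_isUnit_det, det_mul, det_mul, hdet]
    exact (hSd.mul (by simp)).mul ((isUnit_nonsing_inv_det_iff).2 hSd)
  · have h2 : S⁻¹ᵀ * (Sᵀ * M * S) * S⁻¹ = M := by
      rw [← Matrix.mul_assoc, ← Matrix.mul_assoc, ← transpose_mul, mul_nonsing_inv _ hSd,
        transpose_one, Matrix.one_mul, Matrix.mul_assoc, mul_nonsing_inv _ hSd, Matrix.mul_one]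
    calc (S * E * S⁻¹)ᵀ * M * (S * E * S⁻¹) = S⁻¹ᵀ * (Eᵀ * (Sᵀ * M * S) * E) * S⁻¹ := by
          rw [transpose_mul, transpose_mul]
          simp only [Matrix.mul_assoc]
      _ = M := by rw [hE, h2]

end Models

/-- over an algebraically closed field of characteristic not 2,
`M ∉ Ξ_n(F)` iff `M` has a direct summand for congruence of the form `Γ_r` with `r` odd
or `J_s(0)` with `s` odd. -/
theorem stmt_15 {F : Type*} [Field F] [IsAlgClosed F] (hchar : (2 : F) ≠ 0) {n : ℕ}
    (M : Matrix (Fin n) (Fin n) F) :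
    ¬ XiMem M ↔
      (∃ r : ℕ, Odd r ∧ CongSummand M (Gam r : Matrix (Fin r) (Fin r) F)) ∨
      (∃ s : ℕ, Odd s ∧ CongSummand M (jordanBlock s (0 : F))) := by
  constructor
  · intro hM
    simp only [XiMem, not_forall] at hM
    obtain ⟨S, hS, hSM, hdet⟩ := hM
    obtain ⟨γ, k, x, y, h⟩ := exists_oddChain_of_isometry hchar hSM
      ((isUnit_iff_isUnit_det _).1 hS).ne_zero hdet
    by_cases hγ : γ = 0
    · subst hγ
      obtain ⟨x', y', h'⟩ := jordanBlock_oddChain hchar k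
      exact Or.inr ⟨2 * k + 1, odd_two_mul_add_one k, h.congSummand hchar h'⟩
    · obtain ⟨x, y, h⟩ := h.exists_normalized hγ
      obtain ⟨x', y', h'⟩ := Gam_oddChain hchar k
      exact Or.inl ⟨2 * k + 1, odd_two_mul_add_one k, h.congSummand hchar h'⟩
  · rintro (⟨r, hr, h⟩ | ⟨s, hs, h⟩)
    · exact not_xiMem_of_congSummand hchar hr h
    · exact not_xiMem_of_congSummand hchar hs h
end
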